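/- arXiv:2003.06204 — 5 statements merged into one kernel-verified Lean document; each statement's English description precedes it below -/
import Mathlib

section
/- The Grötzsch graph admits no semi-transitive orientation; that is, the Grötzsch graph is not semi-transitive. -/
/-- `D` is an orientation of the simple graph `G`: every edge gets exactly one direction. -/
def SimpleGraph.IsOrientation {V : Type*} (G : SimpleGraph V) (D : V → V → Prop) : Prop :=
  (∀ u v, G.Adj u v ↔ D u v ∨ D v u) ∧ ∀ u v, D u v → ¬ D v u

/-- A digraph (given as a relation) is acyclic: no directed cycle. -/
def DigraphAcyclic {V : Type*} (D : V → V → Prop) : Prop :=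
  ∀ v, ¬ Relation.TransGen D v v

/-- `D` is a semi-transitive orientation of `G`: it is an acyclic orientation such that for every
directed path `p 0 → p 1 → ⋯ → p k`, either `p 0` and `p k` are non-adjacent in `G`, or
`p i → p j` is an arc for all `i < j`. -/
def SimpleGraph.IsSemitransitiveOrientation {V : Type*} (G : SimpleGraph V)
    (D : V → V → Prop) : Prop :=
  G.IsOrientation D ∧ DigraphAcyclic D ∧
    ∀ (k : ℕ) (p : Fin (k + 1) → V),
      (∀ i : Fin k, D (p i.castSucc) (p i.succ)) →
      (¬ G.Adj (p 0) (p (Fin.last k)) ∨ ∀ i j : Fin (k + 1), i < j → D (p i) (p j))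

/-- A graph is semi-transitive if it admits a semi-transitive orientation. -/
def SimpleGraph.Semitransitive {V : Type*} (G : SimpleGraph V) : Prop :=
  ∃ D : V → V → Prop, G.IsSemitransitiveOrientation D

/-- The Grötzsch graph: vertices are `none` (the apex `c`), `some (false, i)` (the cycle vertices
`u i`) and `some (true, i)` (the vertices `w i`), with indices `i : ZMod 5`. Its edges are
`u i — u (i+1)`, `w i — u (i+1)`, `w i — u (i-1)` and `c — w i`. -/
def grotzschGraph : SimpleGraph (Option (Bool × ZMod 5)) :=
  SimpleGraph.fromRel (fun a b =>
    (∃ i : ZMod 5, a = some (false, i) ∧ b = some (false, i + 1)) ∨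
    (∃ i : ZMod 5, a = some (true, i) ∧ (b = some (false, i + 1) ∨ b = some (false, i - 1))) ∨
    (∃ i : ZMod 5, a = none ∧ b = some (true, i)))

/-- The sign of the ordered pair `(u, v)` with respect to `D`: `1` along an arc, `-1` otherwise. -/
noncomputable def arcSign {V : Type*} (D : V → V → Prop) (u v : V) : ℤ :=
  open Classical in if D u v then 1 else -1

lemma arcSign_eq_one_or {V : Type*} (D : V → V → Prop) (u v : V) :
    arcSign D u v = 1 ∨ arcSign D u v = -1 := by
  unfold arcSign
  split_ifs <;> simp

lemma SimpleGraph.IsOrientation.arcSign_symm {V : Type*} {G : SimpleGraph V} {D : V → V → Prop}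
    (h : G.IsOrientation D) {u v : V} (huv : G.Adj u v) : arcSign D v u = -arcSign D u v := by
  have h₁ := (h.1 u v).1 huv
  have h₂ := h.2 u v
  unfold arcSign
  split_ifs <;> simp_all

namespace SimpleGraph.IsSemitransitiveOrientation

variable {V : Type*} {G : SimpleGraph V} {D : V → V → Prop}

/-- A directed path on four vertices with adjacent endpoints has its chords as arcs. -/
lemma chords_of_path (h : G.IsSemitransitiveOrientation D) {a b c d : V}
    (hab : D a b) (hbc : D b c) (hcd : D c d) (had : G.Adj a d) : D a c ∧ D b d := by
  rcases h.2.2 3 ![a, b, c, d] (by intro i; fin_cases i <;> assumption) with h' | h'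
  · exact absurd had h'
  · exact ⟨h' 0 2 (by decide), h' 1 3 (by decide)⟩

/-- In a 4-cycle `a b c d` with a missing chord `a c`, the two paths from `a` to `c` have the same
total sign. -/
lemma arcSign_add_eq (h : G.IsSemitransitiveOrientation D) {a b c d : V}
    (hab : G.Adj a b) (hbc : G.Adj b c) (had : G.Adj a d) (hdc : G.Adj d c) (hac : ¬ G.Adj a c) :
    arcSign D a b + arcSign D b c = arcSign D a d + arcSign D d c := by
  have nac : ¬ D a c := fun hD => hac ((h.1.1 a c).2 (.inl hD))
  have nca : ¬ D c a := fun hD => hac ((h.1.1 a c).2 (.inr hD))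
  have p₁ (x : D a b) (y : D b c) (z : D c d) : False := nac (h.chords_of_path x y z had).1
  have p₂ (x : D b c) (y : D c d) (z : D d a) : False := nca (h.chords_of_path x y z hab.symm).2
  have p₃ (x : D c d) (y : D d a) (z : D a b) : False := nca (h.chords_of_path x y z hbc.symm).1
  have p₄ (x : D d a) (y : D a b) (z : D b c) : False := nac (h.chords_of_path x y z hdc).2
  have q₁ (x : D a d) (y : D d c) (z : D c b) : False := nac (h.chords_of_path x y z hab).1
  have q₂ (x : D d c) (y : D c b) (z : D b a) : False := nca (h.chords_of_path x y z had.symm).2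
  have q₃ (x : D c b) (y : D b a) (z : D a d) : False := nca (h.chords_of_path x y z hdc.symm).1
  have q₄ (x : D b a) (y : D a d) (z : D d c) : False := nac (h.chords_of_path x y z hbc).2
  have e₁ := (h.1.1 a b).1 hab
  have e₂ := (h.1.1 b c).1 hbc
  have e₃ := (h.1.1 a d).1 had
  have e₄ := (h.1.1 d c).1 hdc
  have s₁ := h.1.2 a b
  have s₂ := h.1.2 b c
  have s₃ := h.1.2 a d
  have s₄ := h.1.2 d c
  clear h hab hbc had hdc hac nac nca
  unfold arcSign
  grind

end SimpleGraph.IsSemitransitiveOrientation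

lemma grotzschGraph_adj_cycle (i : ZMod 5) :
    grotzschGraph.Adj (some (false, i)) (some (false, i + 1)) := by
  have : (1 : ZMod 5) ≠ 0 := by decide
  simp [grotzschGraph, this]

lemma grotzschGraph_adj_succ (i : ZMod 5) :
    grotzschGraph.Adj (some (true, i)) (some (false, i + 1)) := by
  simp [grotzschGraph]

lemma grotzschGraph_adj_pred (i : ZMod 5) :
    grotzschGraph.Adj (some (false, i)) (some (true, i + 1)) := by
  simp [grotzschGraph]

lemma grotzschGraph_adj_apex (i : ZMod 5) : grotzschGraph.Adj none (some (true, i)) := by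
  simp [grotzschGraph]

lemma grotzschGraph_not_adj_cycle (i : ZMod 5) :
    ¬ grotzschGraph.Adj (some (false, i)) (some (false, i + 1 + 1)) := by
  simp only [grotzschGraph, SimpleGraph.fromRel_adj]
  revert i
  simp
  decide

lemma grotzschGraph_not_adj_apex (i : ZMod 5) :
    ¬ grotzschGraph.Adj none (some (false, i)) := by
  simp [grotzschGraph]

/-- The Grötzsch graph is not semi-transitive. -/
theorem grotzschGraph_not_semitransitive : ¬ grotzschGraph.Semitransitive := by
  rintro ⟨D, h⟩
  let A (i : ZMod 5) := arcSign D (some (false, i)) (some (true, i + 1))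
  let B (i : ZMod 5) := arcSign D (some (true, i)) (some (false, i + 1))
  let X (i : ZMod 5) := arcSign D (some (false, i)) (some (false, i + 1))
  let Y (i : ZMod 5) := arcSign D none (some (true, i))
  have hAB (i : ZMod 5) : A i + B (i + 1) = X i + X (i + 1) :=
    h.arcSign_add_eq (grotzschGraph_adj_pred i) (grotzschGraph_adj_succ _)
      (grotzschGraph_adj_cycle i) (grotzschGraph_adj_cycle _) (grotzschGraph_not_adj_cycle i)
  have hY (i : ZMod 5) : Y i + B i = Y (i + 1 + 1) + -A (i + 1) := by
    rw [← h.1.arcSign_symm (grotzschGraph_adj_pred (i + 1))]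
    exact h.arcSign_add_eq (grotzschGraph_adj_apex i) (grotzschGraph_adj_succ i)
      (grotzschGraph_adj_apex _) (grotzschGraph_adj_pred _).symm (grotzschGraph_not_adj_apex _)
  have shift (f : ZMod 5 → ℤ) : ∑ i, f (i + 1) = ∑ i, f i := Equiv.sum_comp (Equiv.addRight 1) f
  have sAB := Finset.sum_congr rfl fun i (_ : i ∈ Finset.univ) => hAB i
  have sY := Finset.sum_congr rfl fun i (_ : i ∈ Finset.univ) => hY i
  simp only [Finset.sum_add_distrib, Finset.sum_neg_distrib] at sAB sY
  rw [shift B, shift X] at sAB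
  rw [shift (fun i => Y (i + 1)), shift Y, shift A] at sY
  have hX : ∑ i, X i = X 0 + X 1 + X 2 + X 3 + X 4 := Fin.sum_univ_five X
  have hx (i : ZMod 5) : X i = 1 ∨ X i = -1 := arcSign_eq_one_or D _ _
  have := hx 0
  have := hx 1
  have := hx 2
  have := hx 3
  have := hx 4
  omega
end

section
/- The graph obtained from the Chvátal graph by deleting the edge {5,6} admits no semi-transitive orientation; that is, it is not semi-transitive. -/
/-- The Chvátal graph on vertices `0, …, 11` (representing `1, …, 12`): the 4-regular
triangle-free graph with the 24 listed edges. -/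
def chvatalGraph : SimpleGraph (Fin 12) :=
  SimpleGraph.fromRel (fun a b => (a, b) ∈
    ([(0, 1), (0, 3), (0, 6), (0, 11), (1, 2), (1, 5), (1, 8), (2, 3), (2, 7), (2, 10),
      (3, 4), (3, 9), (4, 5), (4, 8), (4, 11), (5, 6), (5, 9), (6, 7), (6, 10), (7, 8),
      (7, 11), (8, 9), (9, 10), (10, 11)] : List (Fin 12 × Fin 12)))

open Relation

/-- In a semi-transitive orientation of a triangle-free graph, the ends of a directed path with at
least two arcs are never adjacent. -/
theorem SimpleGraph.IsSemitransitiveOrientation.not_adj_of_transGen {V : Type*}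
    {G : SimpleGraph V} {D : V → V → Prop} (hD : G.IsSemitransitiveOrientation D)
    (hG : G.CliqueFree 3) {u w v : V} (huw : TransGen D u w) (hwv : TransGen D w v) :
    ¬ G.Adj u v := by
  classical
  obtain ⟨x, hux, hxw⟩ := TransGen.head'_iff.1 huw
  obtain ⟨y, hxy, hyv⟩ := TransGen.head'_iff.1 (TransGen.trans_right hxw hwv)
  obtain ⟨l, hl, hlast⟩ := List.exists_isChain_cons_of_relationReflTransGen hyv
  have hchain : (u :: x :: y :: l).IsChain D := by simp [hux, hxy, hl]
  intro huv
  rcases hD.2.2 (l.length + 2) (fun i => (u :: x :: y :: l)[i]'(by simp; omega))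
    (fun i => List.isChain_iff_getElem.1 hchain i (by simp; omega)) with h | h
  · refine h ?_
    have : (u :: x :: y :: l)[l.length + 2] = v := by
      rw [← hlast, List.getLast_eq_getElem]
      simp
    simpa [this] using huv
  · have huy : D u y := h 0 ⟨2, by omega⟩ (by simp [Fin.lt_def])
    have adj : ∀ {a b}, D a b → G.Adj a b := fun hab => (hD.1.1 _ _).2 (Or.inl hab)
    exact hG {u, x, y} (SimpleGraph.is3Clique_triple_iff.2 ⟨adj hux, adj huy, adj hxy⟩)

section Search

variable {V : Type*} [DecidableEq V]

/-- The pairs joined by a directed path with at least two arcs through a new arc `u → v`, given the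
list `R` of pairs that are already joined by a directed path. -/
def pairsThroughArc (R : List (V × V)) (u v : V) : List (V × V) :=
  let sources := (R.filter (·.2 = u)).map Prod.fst
  let targets := (R.filter (·.1 = v)).map Prod.snd
  sources.map (·, v) ++ targets.map (u, ·) ++ sources.product targets

/-- Backtracking search over the orientations of the edges in a list. It returns `true` if every
choice of directions creates a directed path with at least two arcs whose ends are adjacent in the
graph with edge list `E`; `R` lists the pairs already joined by a directed path. -/
def refutesOrientations (E : List (V × V)) : List (V × V) → List (V × V) → Bool
  | [], _ => false
  | (u, v) :: es, R =>
    let refutesArc (a b : V) : Bool :=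
      let P := pairsThroughArc R a b
      P.any (fun p => p ∈ E || p.swap ∈ E) ||
        refutesOrientations E es ((a, b) :: (P.filter (· ∉ R) ++ R))
    refutesArc u v && refutesArc v u

theorem transGen_of_mem_pairsThroughArc {D : V → V → Prop} {R : List (V × V)}
    (hR : ∀ p ∈ R, TransGen D p.1 p.2) {u v : V} (huv : D u v) {p : V × V}
    (hp : p ∈ pairsThroughArc R u v) :
    ∃ w, TransGen D p.1 w ∧ TransGen D w p.2 := by
  obtain ⟨a, b⟩ := p
  simp only [pairsThroughArc, List.mem_append, List.mem_map, List.mem_filter, decide_eq_true_eq,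
    List.pair_mem_product, Prod.exists, Prod.mk.injEq] at hp
  rcases hp with (⟨_, ⟨c, _, ⟨hc, h⟩, rfl⟩, rfl, rfl⟩ | ⟨_, ⟨_, c, ⟨hc, h⟩, rfl⟩, rfl, rfl⟩) |
    ⟨⟨c, _, ⟨hc, h⟩, rfl⟩, ⟨_, d, ⟨hd, h'⟩, rfl⟩⟩
  · exact ⟨_, h ▸ hR _ hc, .single huv⟩
  · exact ⟨_, .single huv, h ▸ hR _ hc⟩
  · exact ⟨_, h ▸ hR _ hc, .head huv (h' ▸ hR _ hd)⟩

theorem refutesOrientations_sound {D : V → V → Prop} {E : List (V × V)}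
    (hE : ∀ u w v, TransGen D u w → TransGen D w v → (u, v) ∉ E ∧ (v, u) ∉ E)
    (es R : List (V × V)) (hes : ∀ e ∈ es, D e.1 e.2 ∨ D e.2 e.1)
    (hR : ∀ p ∈ R, TransGen D p.1 p.2) :
    refutesOrientations E es R = false := by
  induction es generalizing R with
  | nil => rfl
  | cons e es ih =>
    obtain ⟨u, v⟩ := e
    have arc : ∀ a b, D a b →
        ((pairsThroughArc R a b).any (fun p => p ∈ E || p.swap ∈ E) || refutesOrientations E es
          ((a, b) :: ((pairsThroughArc R a b).filter (· ∉ R) ++ R))) = false := by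
      intro a b hab
      rw [Bool.or_eq_false_iff, List.any_eq_false]
      refine ⟨fun p hp => ?_, ih _ (fun e he => hes e (List.mem_cons_of_mem _ he)) ?_⟩
      · obtain ⟨w, h₁, h₂⟩ := transGen_of_mem_pairsThroughArc hR hab hp
        obtain ⟨h₃, h₄⟩ := hE _ _ _ h₁ h₂
        simp [h₃, h₄, Prod.swap]
      · intro p hp
        simp only [List.mem_cons, List.mem_append, List.mem_filter] at hp
        rcases hp with rfl | ⟨hp, -⟩ | hp
        · exact .single hab
        · obtain ⟨w, h₁, h₂⟩ := transGen_of_mem_pairsThroughArc hR hab hp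
          exact h₁.trans h₂
        · exact hR p hp
    rw [refutesOrientations, Bool.and_eq_false_iff]
    exact (hes (u, v) List.mem_cons_self).imp (arc u v) (arc v u)

end Search

/-- The edges of the Chvátal graph without `{4, 5}`, in an order that keeps the search small. -/
def chvatalDeletedEdges : List (Fin 12 × Fin 12) :=
  [(2, 10), (9, 10), (3, 9), (2, 3), (2, 7), (7, 8), (1, 8), (1, 2), (7, 11), (4, 11), (4, 8),
    (8, 9), (3, 4), (6, 10), (6, 7), (0, 3), (0, 11), (0, 1), (0, 6), (1, 5), (5, 9), (5, 6),
    (10, 11)]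

theorem chvatalGraph_deleteEdge_adj_iff (u v : Fin 12) :
    (chvatalGraph.deleteEdges {s(4, 5)}).Adj u v ↔
      (u, v) ∈ chvatalDeletedEdges ∨ (v, u) ∈ chvatalDeletedEdges := by
  simp only [SimpleGraph.deleteEdges_adj, chvatalGraph, SimpleGraph.fromRel_adj,
    Set.mem_singleton_iff]
  revert u v
  decide +kernel

set_option synthInstance.maxSize 1000 in
theorem chvatalGraph_deleteEdge_cliqueFree :
    (chvatalGraph.deleteEdges {s(4, 5)}).CliqueFree 3 := by
  intro s hs
  obtain ⟨a, b, c, hab, hac, hbc, -⟩ := SimpleGraph.is3Clique_iff.1 hs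
  rw [chvatalGraph_deleteEdge_adj_iff] at hab hac hbc
  refine absurd hbc ?_
  clear hbc
  revert a b c
  decide +kernel

theorem refutesOrientations_chvatalDeletedEdges :
    refutesOrientations chvatalDeletedEdges chvatalDeletedEdges [] = true := by
  decide +kernel

/-- The graph obtained from the Chvátal graph by deleting the edge `{5, 6}` (in the paper's
1-based labelling, i.e. the edge between vertices `4` and `5` here) is not semi-transitive. -/
theorem chvatalGraph_deleteEdge_not_semitransitive :
    ¬ (chvatalGraph.deleteEdges {s(4, 5)}).Semitransitive := by
  rintro ⟨D, hD⟩
  have h := refutesOrientations_sound (D := D) (E := chvatalDeletedEdges)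
    (fun u w v huw hwv => not_or.1 fun h =>
      hD.not_adj_of_transGen chvatalGraph_deleteEdge_cliqueFree huw hwv
        ((chvatalGraph_deleteEdge_adj_iff u v).2 h))
    chvatalDeletedEdges []
    (fun e he => (hD.1.1 _ _).1 ((chvatalGraph_deleteEdge_adj_iff _ _).2 (Or.inl he)))
    (by simp)
  simp [refutesOrientations_chvatalDeletedEdges] at h
end

section
/- Every triangle-free 4-regular finite simple graph on fewer than 12 vertices is semi-transitive. Consequently, the Chvátal graph, having 12 vertices, is a minimal 4-regular triangle-free non-semi-transitive graph. -/
namespace SimpleGraph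

variable {V : Type*} {G : SimpleGraph V}

lemma CliqueFree.not_adj (hG : G.CliqueFree 3) {a b c : V} (hab : G.Adj a b) (hac : G.Adj a c) :
    ¬ G.Adj b c := by
  classical
  exact fun hbc => hG _ (is3Clique_iff.2 ⟨a, b, c, hab, hac, hbc, rfl⟩)

/-- Directing the edges of a triangle-free graph from smaller to larger colours in a 3-colouring
gives a semi-transitive orientation: directed paths have at most two arcs. -/
lemma Coloring.semitransitive_of_three (C : G.Coloring (Fin 3)) (hG : G.CliqueFree 3) :
    G.Semitransitive := by
  refine ⟨fun u v => G.Adj u v ∧ C u < C v, ⟨fun u v => ?_, fun u v h h' => ?_⟩, fun v hv => ?_,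
    fun k p hp => ?_⟩
  · refine ⟨fun h => ?_, fun h => h.elim And.left fun h => h.1.symm⟩
    exact (lt_or_gt_of_ne (C.valid h)).imp (⟨h, ·⟩) (⟨h.symm, ·⟩)
  · exact h.2.asymm h'.2
  · have hlt : ∀ u, Relation.TransGen (fun u v => G.Adj u v ∧ C u < C v) v u → C v < C u := by
      intro u hu
      induction hu with
      | single h => exact h.2
      | tail _ h ih => exact ih.trans h.2
    exact (hlt v hv).false
  · match k with
    | 0 => exact .inr fun i j hij => absurd hij (by omega)
    | 1 =>
      refine .inr fun i j hij => ?_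
      obtain ⟨rfl, rfl⟩ : i = 0 ∧ j = 1 := by revert i j; decide
      exact hp 0
    | 2 =>
      exact .inl fun h => hG.not_adj (hp 0).1 h (hp 1).1
    | k + 3 =>
      have h0 : C (p ⟨0, by omega⟩) < C (p ⟨1, by omega⟩) := (hp ⟨0, by omega⟩).2
      have h1 : C (p ⟨1, by omega⟩) < C (p ⟨2, by omega⟩) := (hp ⟨1, by omega⟩).2
      have h2 : C (p ⟨2, by omega⟩) < C (p ⟨3, by omega⟩) := (hp ⟨2, by omega⟩).2
      omega

/-- A graph that is not bipartite contains an odd closed walk without repeated vertices. -/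
lemma exists_odd_loop_injOn (h : ¬ G.Colorable 2) :
    ∃ (u : V) (p : G.Walk u u), Odd p.length ∧ Set.InjOn p.getVert (Set.Iio p.length) := by
  classical
  simp only [two_colorable_iff_forall_loop_even, not_forall, Nat.not_even_iff_odd] at h
  have hex : ∃ n, ∃ (u : V) (p : G.Walk u u), Odd p.length ∧ p.length = n := by
    obtain ⟨u, p, hp⟩ := h
    exact ⟨_, u, p, hp, rfl⟩
  obtain ⟨u, p, hp, hlen⟩ := Nat.find_spec hex
  have hmin : ∀ (v : V) (q : G.Walk v v), Odd q.length → p.length ≤ q.length :=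
    fun v q hq => hlen ▸ Nat.find_min' hex ⟨v, q, hq, rfl⟩
  have key : ∀ i j, i < j → j < p.length → p.getVert i ≠ p.getVert j := by
    intro i j hij hj heq
    have hinner : (p.drop i).getVert (j - i) = p.getVert i := by
      rw [Walk.drop_getVert, heq]; congr 1; omega
    have h1 := hmin _ (((p.drop i).take (j - i)).copy rfl hinner)
    have h2 := hmin _ ((p.take i).append ((p.drop j).copy heq.symm rfl))
    simp only [Walk.length_copy, Walk.take_length, Walk.drop_length, Walk.length_append] at h1 h2
    rcases Nat.even_or_odd (j - i) with he | ho
    · have : Odd (min i p.length + (p.length - j)) := by grind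
      have := h2 this
      omega
    · have : Odd (min (j - i) (p.length - i)) := by grind
      have := h1 this
      omega
  refine ⟨u, p, hp, fun i hi j hj hij => ?_⟩
  by_contra hne
  rcases lt_or_gt_of_ne hne with hlt | hlt
  · exact key i j hlt hj hij
  · exact key j i hlt hi hij.symm

/-- In a triangle-free graph a vertex has at most two neighbours on a closed walk of length five. -/
lemma CliqueFree.card_filter_adj_le_two [DecidableRel G.Adj] (hG : G.CliqueFree 3) {c : Fin 5 → V}
    (hc : ∀ i, G.Adj (c i) (c (i + 1))) (x : V) :
    (Finset.univ.filter fun i => G.Adj x (c i)).card ≤ 2 := by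
  have hind : ∀ s : Finset (Fin 5), (∀ i ∈ s, i + 1 ∉ s) → s.card ≤ 2 := by decide
  refine hind _ fun i hi hi' => ?_
  simp only [Finset.mem_filter, Finset.mem_univ, true_and] at hi hi'
  exact hG.not_adj hi hi' (hc i)

/-- In a triangle-free 4-regular graph on at most eleven vertices, no 5-cycle avoids the closed
neighbourhood of a vertex. -/
lemma CliqueFree.not_five_cycle [Fintype V] [DecidableRel G.Adj]
    (hG : G.CliqueFree 3) (hreg : G.IsRegularOfDegree 4) (hV : Fintype.card V < 12) (v : V)
    {c : Fin 5 → V} (hinj : c.Injective) (hc : ∀ i, G.Adj (c i) (c (i + 1)))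
    (hv : ∀ i, ¬ G.Adj v (c i)) : False := by
  classical
  have hcv : ∀ i, c i ≠ v := fun i h => hv (i + 1) (h ▸ hc i)
  have hdeg : ∀ x, (G.neighborFinset x).card = 4 := fun x => hreg x
  set B : Finset V := insert v (G.neighborFinset v ∪ Finset.univ.image c) with hB
  have hBcard : B.card = 10 := by
    rw [hB, Finset.card_insert_of_notMem (by simpa using hcv), Finset.card_union_of_disjoint,
      hdeg, Finset.card_image_of_injective _ hinj]
    · rfl
    · simpa [Finset.disjoint_right] using hv
  have hWcard : Bᶜ.card ≤ 1 := by
    rw [Finset.card_compl, hBcard]; omega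
  have hW : ∀ a, G.Adj v a → ∃ w ∈ Bᶜ, G.Adj a w := by
    intro a ha
    by_contra! hcon
    have hsub : G.neighborFinset a ⊆
        insert v ((Finset.univ.filter fun i => G.Adj a (c i)).image c) := by
      intro x hx
      have hxa : G.Adj a x := by simpa using hx
      have hxB : x ∈ B := by
        by_contra hxB
        exact hcon x (by simpa using hxB) hxa
      have hvx : ¬ G.Adj v x := fun h => hG.not_adj ha h hxa
      simp only [hB, Finset.mem_insert, Finset.mem_union, mem_neighborFinset, hvx, false_or,
        Finset.mem_image, Finset.mem_univ, true_and] at hxB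
      rcases hxB with rfl | ⟨i, rfl⟩
      · simp
      · simp only [Finset.mem_insert, Finset.mem_image, Finset.mem_filter, Finset.mem_univ,
          true_and]
        exact .inr ⟨i, hxa, rfl⟩
    have h1 := Finset.card_le_card hsub
    have h2 := Finset.card_insert_le v ((Finset.univ.filter fun i => G.Adj a (c i)).image c)
    have h3 : ((Finset.univ.filter fun i => G.Adj a (c i)).image c).card ≤ _ :=
      Finset.card_image_le
    have h4 := hG.card_filter_adj_le_two hc a
    have h5 := hdeg a
    omega
  obtain ⟨a₀, ha₀⟩ : (G.neighborFinset v).Nonempty := by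
    rw [← Finset.card_pos, hdeg]; norm_num
  obtain ⟨w, hw, -⟩ := hW a₀ (by simpa using ha₀)
  have hWw : ∀ x ∈ Bᶜ, x = w := fun x hx => Finset.card_le_one.1 hWcard x hx w hw
  have hwN : G.neighborFinset w = G.neighborFinset v := by
    refine (Finset.eq_of_subset_of_card_le (fun a ha => ?_) (by rw [hdeg, hdeg])).symm
    obtain ⟨x, hx, hax⟩ := hW a (by simpa using ha)
    rw [hWw x hx] at hax
    simpa using hax.symm
  have hwc : ∀ i, ¬ G.Adj (c i) w := by
    intro i h
    have : c i ∈ G.neighborFinset w := by simpa using h.symm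
    rw [hwN] at this
    exact hv i (by simpa using this)
  have hlow : ∀ i ∈ (Finset.univ : Finset (Fin 5)),
      2 ≤ ((G.neighborFinset v).bipartiteBelow (fun a i => G.Adj a (c i)) i).card := by
    intro i _
    have hsub : G.neighborFinset (c i) ⊆
        (G.neighborFinset v).bipartiteBelow (fun a i => G.Adj a (c i)) i ∪
        (Finset.univ.filter fun j => G.Adj (c i) (c j)).image c := by
      intro x hx
      have hxa : G.Adj (c i) x := by simpa using hx
      have hxB : x ∈ B := by
        by_contra hxB
        exact hwc i (hWw x (by simpa using hxB) ▸ hxa)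
      simp only [hB, Finset.mem_insert, Finset.mem_union, mem_neighborFinset,
        Finset.mem_image, Finset.mem_univ, true_and] at hxB
      simp only [Finset.mem_union, Finset.mem_bipartiteBelow, mem_neighborFinset, Finset.mem_image,
        Finset.mem_filter, Finset.mem_univ, true_and]
      rcases hxB with rfl | h | ⟨j, rfl⟩
      · exact absurd hxa.symm (hv i)
      · exact .inl ⟨h, hxa.symm⟩
      · exact .inr ⟨j, hxa, rfl⟩
    have h1 := (Finset.card_le_card hsub).trans (Finset.card_union_le _ _)
    have h3 : ((Finset.univ.filter fun j => G.Adj (c i) (c j)).image c).card ≤ _ :=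
      Finset.card_image_le
    have h4 := hG.card_filter_adj_le_two hc (c i)
    have h5 := hdeg (c i)
    omega
  have hcount := Finset.card_mul_le_card_mul' (fun a i => G.Adj a (c i)) hlow
    (fun a _ => hG.card_filter_adj_le_two hc a)
  rw [hdeg] at hcount
  simp at hcount

lemma CliqueFree.colorable_two_induce_not_adj [Fintype V] [DecidableRel G.Adj]
    (hG : G.CliqueFree 3) (hreg : G.IsRegularOfDegree 4) (hV : Fintype.card V < 12) (v : V) :
    (G.induce {x | ¬ G.Adj v x}).Colorable 2 := by
  classical
  by_contra hcol
  obtain ⟨u, p, hodd, hinj⟩ := exists_odd_loop_injOn hcol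
  set c : ℕ → V := fun i => (p.getVert i).1 with hc
  have hadj : ∀ i < p.length, G.Adj (c i) (c (i + 1)) := fun i hi => p.adj_getVert_succ hi
  have hclose : c p.length = c 0 := by simp [hc]
  have hv : ∀ i, ¬ G.Adj v (c i) := fun i => (p.getVert i).2
  have hcv : ∀ i < p.length, c i ≠ v := fun i hi h => hv (i + 1) (h ▸ hadj i hi)
  have hcinj : Set.InjOn c (Finset.range p.length) := by
    intro i hi j hj hij
    exact hinj (by simpa using hi) (by simpa using hj) (Subtype.ext hij)
  have hlen : p.length ≤ 6 := by
    have h1 : (insert v (G.neighborFinset v ∪ (Finset.range p.length).image c)).card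
        = p.length + 5 := by
      rw [Finset.card_insert_of_notMem, Finset.card_union_of_disjoint,
        Finset.card_image_of_injOn hcinj, Finset.card_range, card_neighborFinset_eq_degree, hreg v]
      · omega
      · rw [Finset.disjoint_right]
        simpa using fun i _ => hv i
      · simpa using hcv
    have h2 := Finset.card_le_univ (insert v (G.neighborFinset v ∪ (Finset.range p.length).image c))
    omega
  obtain h | h | h : p.length = 1 ∨ p.length = 3 ∨ p.length = 5 := by
    obtain ⟨m, hm⟩ := hodd
    omega
  · rw [h] at hclose hadj
    exact (hadj 0 (by omega)).ne hclose.symm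
  · rw [h] at hclose hadj
    exact hG.not_adj (hadj 0 (by omega)) (hclose ▸ (hadj 2 (by omega)).symm) (hadj 1 (by omega))
  · rw [h] at hclose hadj hcinj
    refine hG.not_five_cycle hreg hV v (c := fun i => c i) (fun i j hij => ?_) (fun i => ?_)
      (fun i => hv i)
    · exact Fin.ext (hcinj (by simp) (by simp) hij)
    · fin_cases i
      · exact hadj 0 (by omega)
      · exact hadj 1 (by omega)
      · exact hadj 2 (by omega)
      · exact hadj 3 (by omega)
      · exact hclose ▸ hadj 4 (by omega)

/-- Two colours suffice outside the (independent) neighbourhood of any vertex. -/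
lemma CliqueFree.colorable_three [Fintype V] [DecidableRel G.Adj]
    (hG : G.CliqueFree 3) (hreg : G.IsRegularOfDegree 4) (hV : Fintype.card V < 12) :
    G.Colorable 3 := by
  classical
  rcases isEmpty_or_nonempty V with hemp | ⟨⟨v⟩⟩
  · exact Colorable.of_isEmpty 3
  obtain ⟨C⟩ := hG.colorable_two_induce_not_adj hreg hV v
  refine ⟨Coloring.mk
    (fun x => if h : G.Adj v x then Fin.last 2 else (C ⟨x, h⟩).castSucc) fun {x y} hxy => ?_⟩
  by_cases hx : G.Adj v x <;> by_cases hy : G.Adj v y <;> simp only [hx, hy, dite_true, dite_false]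
  · exact fun _ => hG.not_adj hx hy hxy
  · exact (Fin.castSucc_lt_last _).ne'
  · exact (Fin.castSucc_lt_last _).ne
  · exact fun h => C.valid (v := ⟨x, hx⟩) (w := ⟨y, hy⟩) hxy (Fin.castSucc_injective _ h)

open scoped Classical in
/-- The value `1` on arcs `u → v` of `D` and `-1` on all other pairs. -/
noncomputable def arcSign (D : V → V → Prop) (u v : V) : ℤ := if D u v then 1 else -1

lemma IsOrientation.arcSign_cases {D : V → V → Prop} (hD : G.IsOrientation D) {u v : V}
    (h : G.Adj u v) :
    arcSign D v u = -arcSign D u v ∧ (arcSign D u v = 1 ∨ arcSign D u v = -1) := by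
  rcases (hD.1 u v).1 h with h | h
  · simp [arcSign, h, hD.2 _ _ h]
  · simp [arcSign, h, hD.2 _ _ h]

/-- A semi-transitive orientation has no directed path of length three whose first and third
vertices are not adjacent while its endpoints are joined by an edge. -/
lemma IsSemitransitiveOrientation.not_three_path {D : V → V → Prop}
    (hD : G.IsSemitransitiveOrientation D) {a b c d : V} (hab : D a b) (hbc : D b c) (hcd : D c d)
    (had : G.Adj a d) (hac : ¬ G.Adj a c) : False := by
  rcases hD.2.2 3 ![a, b, c, d] (by simp [Fin.forall_fin_succ, hab, hbc, hcd]) with h | h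
  · exact h had
  · exact hac ((hD.1.1 a c).2 (.inl (h 0 2 (by decide))))

/-- A semi-transitive orientation directs exactly two edges of an induced 4-cycle each way. -/
lemma IsSemitransitiveOrientation.arcSign_four_cycle {D : V → V → Prop}
    (hD : G.IsSemitransitiveOrientation D) {a b c d : V} (hab : G.Adj a b) (hbc : G.Adj b c)
    (hcd : G.Adj c d) (hda : G.Adj d a) (hac : ¬ G.Adj a c) (hbd : ¬ G.Adj b d) :
    arcSign D a b + arcSign D b c + arcSign D c d + arcSign D d a = 0 := by
  have hca := fun h : G.Adj c a => hac h.symm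
  have hdb := fun h : G.Adj d b => hbd h.symm
  have np := fun {a b c d : V} => hD.not_three_path (a := a) (b := b) (c := c) (d := d)
  have asymm := hD.1.2
  simp only [arcSign]
  rcases (hD.1.1 a b).1 hab with h1 | h1 <;> rcases (hD.1.1 b c).1 hbc with h2 | h2 <;>
    rcases (hD.1.1 c d).1 hcd with h3 | h3 <;> rcases (hD.1.1 d a).1 hda with h4 | h4 <;>
    first
    | exact (np h1 h2 h3 hda.symm hac).elim
    | exact (np h2 h3 h4 hab.symm hbd).elim
    | exact (np h3 h4 h1 hbc.symm hca).elim
    | exact (np h4 h1 h2 hcd.symm hdb).elim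
    | exact (np h3 h2 h1 hda hdb).elim
    | exact (np h2 h1 h4 hcd hca).elim
    | exact (np h1 h4 h3 hbc hbd).elim
    | exact (np h4 h3 h2 hab hac).elim
    | simp [h1, h2, h3, h4, asymm _ _ h1, asymm _ _ h2, asymm _ _ h3, asymm _ _ h4]

end SimpleGraph

section Chvatal

/-- Adjacency in the Chvátal graph is decidable by inspection of its edge list. -/
@[reducible]
def chvatalGraphDecidableRelAdj : DecidableRel chvatalGraph.Adj := by
  unfold chvatalGraph; infer_instance

attribute [local instance] chvatalGraphDecidableRelAdj

lemma chvatalGraph_cliqueFree : chvatalGraph.CliqueFree 3 := by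
  have h : ∀ a b c, chvatalGraph.Adj a b → chvatalGraph.Adj a c → ¬ chvatalGraph.Adj b c := by
    decide
  intro s hs
  obtain ⟨a, b, c, hab, hac, hbc, -⟩ := SimpleGraph.is3Clique_iff.1 hs
  exact h a b c hab hac hbc

lemma chvatalGraph_isRegularOfDegree : chvatalGraph.IsRegularOfDegree 4 := by
  unfold SimpleGraph.IsRegularOfDegree
  decide

lemma chvatalGraph_not_semitransitive : ¬ chvatalGraph.Semitransitive := by
  rintro ⟨D, hD⟩
  have edge : ∀ a b, chvatalGraph.Adj a b → _ := fun a b h => hD.1.arcSign_cases h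
  have cyc : ∀ a b c d, chvatalGraph.Adj a b ∧ chvatalGraph.Adj b c ∧ chvatalGraph.Adj c d ∧
      chvatalGraph.Adj d a ∧ ¬ chvatalGraph.Adj a c ∧ ¬ chvatalGraph.Adj b d → _ :=
    fun a b c d h => hD.arcSign_four_cycle h.1 h.2.1 h.2.2.1 h.2.2.2.1 h.2.2.2.2.1 h.2.2.2.2.2
  clear hD
  generalize SimpleGraph.arcSign D = s at edge cyc
  have := edge 0 1 (by decide)
  have := edge 0 3 (by decide)
  have := edge 0 6 (by decide)
  have := edge 0 11 (by decide)
  have := edge 1 2 (by decide)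
  have := edge 1 5 (by decide)
  have := edge 1 8 (by decide)
  have := edge 2 3 (by decide)
  have := edge 2 7 (by decide)
  have := edge 2 10 (by decide)
  have := edge 3 4 (by decide)
  have := edge 3 9 (by decide)
  have := edge 4 5 (by decide)
  have := edge 4 8 (by decide)
  have := edge 4 11 (by decide)
  have := edge 5 6 (by decide)
  have := edge 5 9 (by decide)
  have := edge 6 7 (by decide)
  have := edge 6 10 (by decide)
  have := edge 7 8 (by decide)
  have := edge 7 11 (by decide)
  have := edge 8 9 (by decide)
  have := edge 9 10 (by decide)
  have := edge 10 11 (by decide)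
  have := cyc 0 1 2 3 (by decide)
  have := cyc 0 1 5 6 (by decide)
  have := cyc 0 3 4 11 (by decide)
  have := cyc 0 6 7 11 (by decide)
  have := cyc 0 6 10 11 (by decide)
  have := cyc 1 2 7 8 (by decide)
  have := cyc 1 5 4 8 (by decide)
  have := cyc 1 5 9 8 (by decide)
  have := cyc 2 3 9 10 (by decide)
  have := cyc 2 7 6 10 (by decide)
  have := cyc 2 7 11 10 (by decide)
  have := cyc 3 4 5 9 (by decide)
  have := cyc 3 4 8 9 (by decide)
  have := cyc 4 5 9 8 (by decide)
  have := cyc 4 8 7 11 (by decide)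
  have := cyc 5 6 10 9 (by decide)
  have := cyc 6 7 11 10 (by decide)
  omega

end Chvatal

open scoped Classical in
/-- Every triangle-free 4-regular graph on fewer than 12 vertices is semi-transitive;
consequently the Chvátal graph, a 4-regular triangle-free non-semi-transitive graph on
12 vertices, is a minimal 4-regular triangle-free non-semi-transitive graph. -/
theorem chvatal_minimal_4regular_triangle_free_non_semitransitive :
    (∀ (V : Type) [Fintype V] (G : SimpleGraph V),
        Fintype.card V < 12 → G.CliqueFree 3 → G.IsRegularOfDegree 4 → G.Semitransitive) ∧
    Fintype.card (Fin 12) = 12 ∧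
    chvatalGraph.CliqueFree 3 ∧
    chvatalGraph.IsRegularOfDegree 4 ∧
    ¬ chvatalGraph.Semitransitive := by
  refine ⟨fun V _ G hV hG hreg => ?_, Fintype.card_fin 12, chvatalGraph_cliqueFree, ?_,
    chvatalGraph_not_semitransitive⟩
  · obtain ⟨C⟩ := hG.colorable_three hreg hV
    exact C.semitransitive_of_three hG
  · convert chvatalGraph_isRegularOfDegree
end

section
/- The circulant graph C(13; 1, 5) is semi-transitive, 4-regular, triangle-free, has girth 4, and has chromatic number 4. -/
/-- The circulant graph `C(n; S)`: vertex set `ZMod n`, with distinct vertices `i, j` adjacent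
iff `i - j ≡ s (mod n)` or `j - i ≡ s (mod n)` for some `s ∈ S`. -/
def circulant (n : ℕ) (S : Set ℤ) : SimpleGraph (ZMod n) :=
  SimpleGraph.fromRel (fun i j => ∃ s ∈ S, i - j = (s : ZMod n))

namespace SimpleGraph

variable {V : Type*} {G : SimpleGraph V}

/-- A proper colouring by `0, 1, 2, 3` of a triangle-free graph, in which no path with increasing
colours `0, 1, 2, 3` closes up to a 4-cycle, gives a semi-transitive orientation: direct every edge
towards its endpoint of larger colour. -/
theorem Coloring.semitransitive_of_fin_four (c : G.Coloring (Fin 4)) (hG : G.CliqueFree 3)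
    (hc : ∀ u v, G.Adj u v → c u < c v → ∀ w, G.Adj v w → c v < c w →
      ∀ x, G.Adj w x → c w < c x → ¬ G.Adj u x) :
    G.Semitransitive := by
  refine ⟨fun u v ↦ G.Adj u v ∧ c u < c v, ⟨fun u v ↦ ⟨fun h ↦ ?_, ?_⟩, ?_⟩, ?_, ?_⟩
  · exact (lt_or_gt_of_ne (c.valid h)).imp (⟨h, ·⟩) (⟨h.symm, ·⟩)
  · rintro (h | h)
    exacts [h.1, h.1.symm]
  · exact fun u v h h' ↦ lt_asymm h.2 h'.2
  · intro v h
    have hlt : Relation.TransGen (· < ·) (c v) (c v) := h.lift c fun _ _ hab ↦ hab.2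
    rw [Relation.transGen_eq_self] at hlt
    exact lt_irrefl _ hlt
  · intro k p hp
    have hmono : StrictMono (c ∘ p) := Fin.strictMono_iff_lt_succ.2 fun i ↦ (hp i).2
    have hk : k + 1 ≤ 4 := by
      simpa using Fintype.card_le_of_injective _ hmono.injective
    obtain rfl | rfl | rfl | rfl : k = 0 ∨ k = 1 ∨ k = 2 ∨ k = 3 := by omega
    · exact .inl G.irrefl
    · refine .inr fun i j hij ↦ ?_
      obtain ⟨rfl, rfl⟩ : i = 0 ∧ j = 1 := by revert i j; decide
      exact hp 0
    · refine .inl fun h ↦ ?_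
      classical
      exact hG {p 0, p 1, p 2} (is3Clique_triple_iff.2 ⟨(hp 0).1, h, (hp 1).1⟩)
    · exact .inl (hc _ _ (hp 0).1 (hp 0).2 _ (hp 1).1 (hp 1).2 _ (hp 2).1 (hp 2).2)

/-- A triangle-free graph containing a 4-cycle has girth 4. -/
theorem CliqueFree.egirth_eq_four (hG : G.CliqueFree 3) {a : V} {w : G.Walk a a}
    (hw : w.IsCycle) (hlen : w.length = 4) : G.egirth = 4 := by
  refine le_antisymm ?_ (le_egirth.2 fun b q hq ↦ ?_)
  · simpa [hlen] using egirth_le_length hw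
  · have h3 : q.length ≠ 3 := fun h ↦ by
      obtain ⟨s, hs⟩ := (is3Clique_iff_exists_cycle_length_three).2 ⟨b, q, hq, h⟩
      exact hG s hs
    have := hq.three_le_length
    exact_mod_cast (by omega : 4 ≤ q.length)

/-- If no `m + 1` vertices are independent, then a graph on more than `n * m` vertices is not
`n`-colourable. -/
theorem not_colorable_of_indepSetFree [Fintype V] {m n : ℕ} (h : G.IndepSetFree (m + 1))
    (hcard : n * m < Fintype.card V) : ¬ G.Colorable n := by
  rintro ⟨c⟩
  obtain ⟨i, hi⟩ := Fintype.exists_lt_card_fiber_of_mul_lt_card c (by simpa using hcard)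
  obtain ⟨s, hs, hs'⟩ := Finset.exists_subset_card_eq (Nat.succ_le_of_lt hi)
  refine h s ⟨fun u hu v hv _ huv ↦ c.valid huv ?_, hs'⟩
  exact (Finset.mem_filter.1 (hs hu)).2.trans (Finset.mem_filter.1 (hs hv)).2.symm

end SimpleGraph

theorem circulant_13_1_5_adj_iff (i j : ZMod 13) :
    (circulant 13 {1, 5}).Adj i j ↔ i - j ∈ ({1, 5, 8, 12} : Finset (ZMod 13)) := by
  simp only [circulant, SimpleGraph.fromRel_adj, Set.mem_insert_iff, Set.mem_singleton_iff,
    exists_eq_or_imp, exists_eq_left]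
  push_cast
  revert i j
  decide +kernel

section Decidable

local instance : DecidableRel (circulant 13 {1, 5}).Adj :=
  fun i j ↦ decidable_of_iff _ (circulant_13_1_5_adj_iff i j).symm

/-- The colours of the colouring `circulantColoring` below. -/
def circulantColor : ZMod 13 → Fin 4 :=
  (![0, 1, 0, 1, 2, 3, 0, 1, 2, 0, 1, 2, 3] : Fin 13 → Fin 4)

theorem circulantColor_ne :
    ∀ i j, (circulant 13 {1, 5}).Adj i j → circulantColor i ≠ circulantColor j := by
  decide +kernel

/-- A proper 4-colouring of `C(13; 1, 5)` without 4-cycles coloured `0, 1, 2, 3` in cyclic order. -/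
def circulantColoring : (circulant 13 {1, 5}).Coloring (Fin 4) :=
  .mk circulantColor (circulantColor_ne _ _)

theorem circulant_13_1_5_cliqueFree : (circulant 13 {1, 5}).CliqueFree 3 := by
  intro s hs
  obtain ⟨a, b, c, hab, hac, hbc, -⟩ := SimpleGraph.is3Clique_iff.1 hs
  have h : ∀ a b, (circulant 13 {1, 5}).Adj a b → ∀ c, (circulant 13 {1, 5}).Adj a c →
      ¬ (circulant 13 {1, 5}).Adj b c := by decide +kernel
  exact h a b hab c hac hbc

theorem circulant_13_1_5_egirth : (circulant 13 {1, 5}).egirth = 4 := by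
  have h₁ : (circulant 13 {1, 5}).Adj 0 1 := by decide +kernel
  have h₂ : (circulant 13 {1, 5}).Adj 1 6 := by decide +kernel
  have h₃ : (circulant 13 {1, 5}).Adj 6 5 := by decide +kernel
  have h₄ : (circulant 13 {1, 5}).Adj 5 0 := by decide +kernel
  refine circulant_13_1_5_cliqueFree.egirth_eq_four
    (w := .cons h₁ (.cons h₂ (.cons h₃ (.cons h₄ .nil)))) ?_ rfl
  rw [SimpleGraph.Walk.cons_isCycle_iff, SimpleGraph.Walk.isPath_def]
  simp only [SimpleGraph.Walk.support_cons, SimpleGraph.Walk.support_nil,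
    SimpleGraph.Walk.edges_cons, SimpleGraph.Walk.edges_nil]
  decide +kernel

theorem circulant_13_1_5_compl_adj_iff (i j : ZMod 13) : (circulant 13 {1, 5})ᶜ.Adj i j ↔
    j - i ∈ ({2, 3, 4, 6, 7, 9, 10, 11} : Finset (ZMod 13)) := by
  rw [SimpleGraph.compl_adj, circulant_13_1_5_adj_iff]
  revert i j
  decide +kernel

theorem circulant_13_1_5_indepSetFree : (circulant 13 {1, 5}).IndepSetFree 5 := by
  rw [← SimpleGraph.cliqueFree_compl]
  by_contra hf
  let f := SimpleGraph.topEmbeddingOfNotCliqueFree hf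
  obtain ⟨T, hT⟩ : ∃ T : Finset (ZMod 13), T = {2, 3, 4, 6, 7, 9, 10, 11} := ⟨_, rfl⟩
  have hadj (i j : Fin 5) (hij : i ≠ j) : f j - f i ∈ T :=
    hT ▸ (circulant_13_1_5_compl_adj_iff _ _).1 (f.map_rel_iff.2 hij)
  have hsub (i j : Fin 5) (hij : i ≠ j) : (f j - f 0) - (f i - f 0) ∈ T := by
    simpa using hadj i j hij
  have h : ∀ x ∈ T, ∀ y ∈ T, y - x ∈ T → ∀ z ∈ T, z - x ∈ T → z - y ∈ T →
      ∀ w ∈ T, w - x ∈ T → w - y ∈ T → w - z ∉ T := by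
    subst hT
    decide +kernel
  exact h _ (hadj 0 1 (by decide)) _ (hadj 0 2 (by decide)) (hsub 1 2 (by decide))
    _ (hadj 0 3 (by decide)) (hsub 1 3 (by decide)) (hsub 2 3 (by decide))
    _ (hadj 0 4 (by decide)) (hsub 1 4 (by decide)) (hsub 2 4 (by decide)) (hsub 3 4 (by decide))

theorem circulant_13_1_5_chromaticNumber : (circulant 13 {1, 5}).chromaticNumber = 4 := by
  rw [show (4 : ℕ∞) = (3 : ℕ) + 1 by norm_num,
    SimpleGraph.chromaticNumber_eq_iff_colorable_not_colorable]
  exact ⟨⟨circulantColoring⟩, SimpleGraph.not_colorable_of_indepSetFree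
    circulant_13_1_5_indepSetFree (by simp [ZMod.card])⟩

theorem circulant_13_1_5_semitransitive : (circulant 13 {1, 5}).Semitransitive :=
  circulantColoring.semitransitive_of_fin_four circulant_13_1_5_cliqueFree (by decide +kernel)

theorem circulant_13_1_5_degree (v : ZMod 13) : (circulant 13 {1, 5}).degree v = 4 := by
  revert v
  decide +kernel

end Decidable

open scoped Classical in
/-- The circulant graph `C(13; 1, 5)` is a semi-transitive, 4-regular, triangle-free graph of
girth 4 with chromatic number 4. -/
theorem circulant_13_1_5 :
    (circulant 13 {1, 5}).Semitransitive ∧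
    (circulant 13 {1, 5}).IsRegularOfDegree 4 ∧
    (circulant 13 {1, 5}).CliqueFree 3 ∧
    (circulant 13 {1, 5}).egirth = 4 ∧
    (circulant 13 {1, 5}).chromaticNumber = 4 := by
  refine ⟨circulant_13_1_5_semitransitive, fun v ↦ ?_, circulant_13_1_5_cliqueFree,
    circulant_13_1_5_egirth, circulant_13_1_5_chromaticNumber⟩
  convert circulant_13_1_5_degree v
end

section
/- Every 4-regular circulant graph is semi-transitive; that is, for every n ≥ 1 and every set S of integers such that the circulant graph C(n; S) is 4-regular, C(n; S) admits a semi-transitive orientation. -/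
namespace SimpleGraph

variable {V W : Type*}

/-- Orienting every edge towards the endpoint of larger rank is a semi-transitive orientation as
soon as every rank-increasing path closed up by an edge spans a clique. -/
theorem semitransitive_of_rank (G : SimpleGraph V) (f : V → ℕ)
    (hf : ∀ u v, G.Adj u v → f u ≠ f v)
    (h : ∀ (k : ℕ) (p : Fin (k + 1) → V),
      (∀ i : Fin k, G.Adj (p i.castSucc) (p i.succ)) → StrictMono (f ∘ p) →
      G.Adj (p 0) (p (Fin.last k)) → ∀ i j : Fin (k + 1), i < j → G.Adj (p i) (p j)) :
    G.Semitransitive := by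
  refine ⟨fun u v => G.Adj u v ∧ f u < f v, ⟨?_, ?_⟩, ?_, ?_⟩
  · intro u v
    constructor
    · intro huv
      rcases lt_or_gt_of_ne (hf u v huv) with hlt | hlt
      · exact Or.inl ⟨huv, hlt⟩
      · exact Or.inr ⟨huv.symm, hlt⟩
    · rintro (huv | huv)
      · exact huv.1
      · exact huv.1.symm
  · exact fun u v huv hvu => lt_asymm huv.2 hvu.2
  · intro v hv
    have key : ∀ u w, Relation.TransGen (fun u v => G.Adj u v ∧ f u < f v) u w → f u < f w := by
      intro u w huw
      induction huw with
      | single hs => exact hs.2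
      | tail _ hs ih => exact ih.trans hs.2
    exact lt_irrefl _ (key v v hv)
  · intro k p hp
    by_cases hadj : G.Adj (p 0) (p (Fin.last k))
    · right
      have hmono : StrictMono (f ∘ p) := Fin.strictMono_iff_lt_succ.2 fun i => (hp i).2
      exact fun i j hij => ⟨h k p (fun i => (hp i).1) hmono hadj i j hij, hmono hij⟩
    · exact Or.inl hadj

/-- A proper `4`-colouring without a closed `4`-cycle coloured `0, 1, 2, 3` in this order yields a
semi-transitive orientation. -/
theorem semitransitive_of_fourColoring (G : SimpleGraph V) (f : V → ℕ) (hf4 : ∀ v, f v < 4)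
    (hf : ∀ u v, G.Adj u v → f u ≠ f v)
    (h : ∀ x y z w, f x = 0 → f y = 1 → f z = 2 → f w = 3 → G.Adj x y → G.Adj y z →
      G.Adj z w → ¬ G.Adj x w) :
    G.Semitransitive := by
  refine G.semitransitive_of_rank f hf ?_
  intro k p hp hmono hadj i j hij
  have hk : k ≤ 3 := by
    have hle : ∀ i : Fin (k + 1), (i : ℕ) ≤ f (p i) := by
      intro i
      induction i using Fin.induction with
      | zero => simp
      | succ i ih =>
        have hs : f (p i.castSucc) < f (p i.succ) := hmono (Fin.castSucc_lt_succ)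
        simp only [Fin.val_castSucc, Fin.val_succ] at ih ⊢
        omega
    have h1 := hle (Fin.last k)
    have h2 := hf4 (p (Fin.last k))
    simp only [Fin.val_last] at h1
    omega
  interval_cases k
  · omega
  · have h01 : G.Adj (p 0) (p 1) := hp 0
    fin_cases i <;> fin_cases j <;> first | exact absurd hij (by decide) | assumption
  · have h01 : G.Adj (p 0) (p 1) := hp 0
    have h12 : G.Adj (p 1) (p 2) := hp 1
    have h02 : G.Adj (p 0) (p 2) := hadj
    fin_cases i <;> fin_cases j <;> first | exact absurd hij (by decide) | assumption
  · exfalso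
    have h01 : f (p 0) < f (p 1) := hmono (by decide : (0 : Fin 4) < 1)
    have h12 : f (p 1) < f (p 2) := hmono (by decide : (1 : Fin 4) < 2)
    have h23 : f (p 2) < f (p 3) := hmono (by decide : (2 : Fin 4) < 3)
    have h3 := hf4 (p 3)
    exact h (p 0) (p 1) (p 2) (p 3) (by omega) (by omega) (by omega) (by omega)
      (hp 0) (hp 1) (hp 2) hadj

/-- `3`-colourable graphs are semi-transitive. -/
theorem semitransitive_of_threeColoring (G : SimpleGraph V) (f : V → ℕ) (hf3 : ∀ v, f v < 3)
    (hf : ∀ u v, G.Adj u v → f u ≠ f v) : G.Semitransitive :=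
  G.semitransitive_of_fourColoring f (fun v => (hf3 v).trans (by norm_num)) hf
    fun _ _ _ w _ _ _ hw => absurd (hf3 w) (by omega)

/-- If `G` is a disjoint union (indexed by the values of `c`) of graphs embedded by `φ` into a
semi-transitive graph, then `G` is semi-transitive. -/
theorem Semitransitive.of_fiberwise {ι : Type*} {G : SimpleGraph V} {H : SimpleGraph W}
    (hH : H.Semitransitive) (c : V → ι) (φ : V → W)
    (h : ∀ u v, G.Adj u v ↔ c u = c v ∧ H.Adj (φ u) (φ v)) : G.Semitransitive := by
  obtain ⟨D, ⟨hD1, hD2⟩, hacyc, hD⟩ := hH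
  refine ⟨fun u v => c u = c v ∧ D (φ u) (φ v), ⟨?_, ?_⟩, ?_, ?_⟩
  · intro u v
    have hcomm : c u = c v ↔ c v = c u := eq_comm
    simp only [h, hD1]
    tauto
  · exact fun u v huv hvu => hD2 _ _ huv.2 hvu.2
  · intro v hv
    exact hacyc (φ v) (Relation.TransGen.lift φ (fun _ _ hab => hab.2) _ _ hv)
  · intro k p hp
    rcases hD k (φ ∘ p) (fun i => (hp i).2) with hno | hyes
    · exact Or.inl fun hadj => hno ((h _ _).1 hadj).2
    · right
      have hc : ∀ i : Fin (k + 1), c (p i) = c (p 0) := by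
        intro i
        induction i using Fin.induction with
        | zero => rfl
        | succ i ih => rw [← (hp i).1, ih]
      exact fun i j hij => ⟨(hc i).trans (hc j).symm, hyes i j hij⟩

end SimpleGraph

/-- The circulant graph on `ZMod n` with connection set `{±a, ±b}`. -/
def circulantPair (n : ℕ) (a b : ZMod n) : SimpleGraph (ZMod n) where
  Adj u v := u ≠ v ∧ (v - u = a ∨ u - v = a ∨ v - u = b ∨ u - v = b)
  symm := ⟨by
    rintro u v ⟨hne, h⟩
    exact ⟨hne.symm, by tauto⟩⟩
  loopless := ⟨fun _ h => h.1 rfl⟩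

theorem circulantPair_adj {n : ℕ} {a b u v : ZMod n} :
    (circulantPair n a b).Adj u v ↔
      u ≠ v ∧ (v - u = a ∨ u - v = a ∨ v - u = b ∨ u - v = b) := Iff.rfl

theorem circulantPair_comm (n : ℕ) (a b : ZMod n) :
    circulantPair n a b = circulantPair n b a := by
  ext u v
  simp only [circulantPair_adj]
  tauto

theorem circulantPair_neg_right (n : ℕ) (a b : ZMod n) :
    circulantPair n a (-b) = circulantPair n a b := by
  ext u v
  have h1 : v - u = -b ↔ u - v = b := by rw [← neg_sub u v, neg_inj]
  have h2 : u - v = -b ↔ v - u = b := by rw [← neg_sub v u, neg_inj]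
  simp only [circulantPair_adj, h1, h2]
  tauto

/-- Multiplying the connection set by a unit yields an isomorphic graph. -/
theorem semitransitive_of_unit_mul {n : ℕ} {a b : ZMod n} (c : ZMod n) (hc : IsUnit c)
    (h : (circulantPair n (c * a) (c * b)).Semitransitive) :
    (circulantPair n a b).Semitransitive := by
  refine h.of_fiberwise (fun _ => ()) (fun x => c * x) fun u v => ?_
  simp only [circulantPair_adj, ← mul_sub, hc.mul_right_inj, true_and, ne_eq]

theorem ZMod.val_sub_dvd_iff {n : ℕ} [NeZero n] (u v : ZMod n) (a : ℤ) :
    v - u = (a : ZMod n) ↔ (n : ℤ) ∣ v.val - u.val - a := by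
  rw [← ZMod.intCast_zmod_eq_zero_iff_dvd]
  push_cast
  rw [ZMod.natCast_zmod_val, ZMod.natCast_zmod_val, sub_eq_zero (b := (a : ZMod n))]

/-- Dividing everything by a common factor `g` decomposes the graph into `g` copies. -/
theorem semitransitive_of_mul_left {g m : ℕ} [NeZero g] [NeZero m] (a b : ℤ)
    (h : (circulantPair m (a : ZMod m) (b : ZMod m)).Semitransitive) :
    (circulantPair (g * m) ((g * a : ℤ) : ZMod (g * m))
      ((g * b : ℤ) : ZMod (g * m))).Semitransitive := by
  have key : ∀ (u v : ZMod (g * m)) (a : ℤ),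
      v - u = ((g * a : ℤ) : ZMod (g * m)) ↔
        u.val % g = v.val % g ∧ ((v.val / g : ℕ) : ZMod m) - ((u.val / g : ℕ) : ZMod m) = a := by
    intro u v a
    have hg : (g : ℤ) ≠ 0 := by exact_mod_cast NeZero.ne g
    have h2 : ((v.val / g : ℕ) : ZMod m) - ((u.val / g : ℕ) : ZMod m) = a ↔
        (m : ℤ) ∣ ((v.val / g : ℕ) : ℤ) - ((u.val / g : ℕ) : ℤ) - a := by
      rw [← ZMod.intCast_zmod_eq_zero_iff_dvd]
      rw [Int.cast_sub, Int.cast_sub, Int.cast_natCast, Int.cast_natCast,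
        sub_eq_zero (b := (a : ZMod m))]
    rw [ZMod.val_sub_dvd_iff, h2]
    have hu : (u.val : ℤ) = g * ((u.val / g : ℕ) : ℤ) + ((u.val % g : ℕ) : ℤ) := by
      exact_mod_cast (Nat.div_add_mod _ _).symm
    have hv : (v.val : ℤ) = g * ((v.val / g : ℕ) : ℤ) + ((v.val % g : ℕ) : ℤ) := by
      exact_mod_cast (Nat.div_add_mod _ _).symm
    generalize v.val / g = qv at *
    generalize u.val / g = qu at *
    have hru := Nat.mod_lt u.val (Nat.pos_of_ne_zero (NeZero.ne g))
    have hrv := Nat.mod_lt v.val (Nat.pos_of_ne_zero (NeZero.ne g))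
    generalize v.val % g = rv at *
    generalize u.val % g = ru at *
    rw [hu, hv]
    push_cast
    constructor
    · intro hd
      have hr : ru = rv := by
        have h1 : (g : ℤ) ∣ (rv : ℤ) - ru := by
          have h3 := dvd_sub ((Dvd.intro _ rfl : (g : ℤ) ∣ g * m).trans hd)
            (Dvd.intro _ rfl : (g : ℤ) ∣ g * (qv - qu - a))
          rwa [show (g : ℤ) * qv + rv - (g * qu + ru) - g * a - g * (qv - qu - a) = rv - ru by
            ring] at h3
        have h2 := Int.eq_zero_of_abs_lt_dvd h1 (by rw [abs_lt]; omega)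
        omega
      refine ⟨hr, ?_⟩
      subst hr
      apply (mul_dvd_mul_iff_left hg).1
      rwa [show (g : ℤ) * (qv - qu - a) = g * qv + ru - (g * qu + ru) - g * a by ring]
    · rintro ⟨rfl, hd⟩
      rw [show (g : ℤ) * qv + ru - (g * qu + ru) - g * a = g * (qv - qu - a) by ring]
      exact mul_dvd_mul_left (g : ℤ) hd
  refine h.of_fiberwise (fun u => u.val % g) (fun u => ((u.val / g : ℕ) : ZMod m)) fun u v => ?_
  simp only [circulantPair_adj, key]
  by_cases huv : u = v
  · subst huv; simp
  · have himp : u.val % g = v.val % g →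
        ((u.val / g : ℕ) : ZMod m) ≠ ((v.val / g : ℕ) : ZMod m) := by
      intro hmod heq
      have := (key u v 0).2 ⟨hmod, by rw [heq]; simp⟩
      simp only [mul_zero, Int.cast_zero, sub_eq_zero] at this
      exact huv this.symm
    rw [eq_comm (a := v.val % g)]
    tauto

/-- The residue of `x` modulo `n` lies in the middle third of `[0, n]`. -/
def InMiddleThird (n x : ℤ) : Prop := n ≤ 3 * (x % n) ∧ 3 * (x % n) ≤ 2 * n

instance (n x : ℤ) : Decidable (InMiddleThird n x) :=
  inferInstanceAs (Decidable (_ ∧ _))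

theorem inMiddleThird_congr {n x y : ℤ} (h : n ∣ x - y) :
    InMiddleThird n x ↔ InMiddleThird n y := by
  rw [InMiddleThird, InMiddleThird, Int.emod_eq_emod_iff_emod_sub_eq_zero.2
    (Int.emod_eq_zero_of_dvd h)]

theorem inMiddleThird_of_between {n x : ℤ} (t : ℤ) (hn : 0 < n) (h1 : n ≤ 3 * (x - t * n))
    (h2 : 3 * (x - t * n) ≤ 2 * n) : InMiddleThird n x := by
  rw [inMiddleThird_congr (y := x - t * n) ⟨t, by ring⟩, InMiddleThird,
    Int.emod_eq_of_lt (by omega) (by omega)]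
  exact ⟨h1, h2⟩

theorem inMiddleThird_neg {n x : ℤ} (hn : 0 < n) (h : InMiddleThird n x) :
    InMiddleThird n (-x) := by
  have hx := Int.emod_add_mul_ediv x n
  obtain ⟨h1, h2⟩ := h
  refine inMiddleThird_of_between (-(x / n) - 1) hn ?_ ?_ <;> linarith

/-- Cutting `ℤ / n` into three arcs separates points at distance at least `n / 3`. -/
theorem third_ne_of_inMiddleThird {n x y a : ℤ} (hn : 0 < n) (ha : InMiddleThird n a)
    (h : n ∣ y - x - a) : 3 * (x % n) / n ≠ 3 * (y % n) / n := by
  intro heq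
  obtain ⟨h1, h2⟩ := (inMiddleThird_congr (y := y % n - x % n) (by
    have hx := Int.emod_add_mul_ediv x n
    have hy := Int.emod_add_mul_ediv y n
    rw [show a - (y % n - x % n) = n * (y / n - x / n) - (y - x - a) by linarith]
    exact dvd_sub (Dvd.intro _ rfl) h)).1 ha
  have hx1 := Int.emod_nonneg x hn.ne'
  have hx2 := Int.emod_lt_of_pos x hn
  have hy1 := Int.emod_nonneg y hn.ne'
  have hy2 := Int.emod_lt_of_pos y hn
  have ex := Int.emod_add_mul_ediv (3 * (x % n)) n
  have ey := Int.emod_add_mul_ediv (3 * (y % n)) n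
  have ex1 := Int.emod_nonneg (3 * (x % n)) hn.ne'
  have ex2 := Int.emod_lt_of_pos (3 * (x % n)) hn
  have ey1 := Int.emod_nonneg (3 * (y % n)) hn.ne'
  have ey2 := Int.emod_lt_of_pos (3 * (y % n)) hn
  rw [heq] at ex
  rcases le_or_gt (x % n) (y % n) with hle | hlt
  · rw [Int.emod_eq_of_lt (by omega) (by omega)] at h1 h2
    linarith
  · rw [← Int.add_emod_right, Int.emod_eq_of_lt (by omega) (by omega)] at h1 h2
    linarith

/-- A dilation moving both generators into the middle third yields a `3`-colouring. -/
theorem semitransitive_of_inMiddleThird {n : ℕ} [NeZero n] {a b : ℤ} (k : ℤ)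
    (ha : InMiddleThird n (k * a)) (hb : InMiddleThird n (k * b)) :
    (circulantPair n (a : ZMod n) (b : ZMod n)).Semitransitive := by
  have hn : (0 : ℤ) < n := by exact_mod_cast Nat.pos_of_ne_zero (NeZero.ne n)
  have hdvd : ∀ (u v : ZMod n) (c : ℤ), v - u = (c : ZMod n) →
      (n : ℤ) ∣ k * v.val - k * u.val - k * c := by
    intro u v c h
    rw [ZMod.val_sub_dvd_iff] at h
    rw [show k * (v.val : ℤ) - k * u.val - k * c = k * (v.val - u.val - c) by ring]
    exact h.mul_left k
  have hnonneg : ∀ v : ZMod n, 0 ≤ 3 * (k * (v.val : ℤ) % n) / n := fun v =>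
    Int.ediv_nonneg (mul_nonneg (by norm_num) (Int.emod_nonneg _ hn.ne')) hn.le
  refine SimpleGraph.semitransitive_of_threeColoring _
    (fun v => (3 * (k * (v.val : ℤ) % n) / n).toNat) ?_ ?_
  · intro v
    have h1 : 3 * (k * (v.val : ℤ) % n) / n < 3 :=
      Int.ediv_lt_of_lt_mul hn (by linarith [Int.emod_lt_of_pos (k * (v.val : ℤ)) hn])
    have := hnonneg v
    omega
  · rintro u v ⟨-, h⟩ heq
    have hu := hnonneg u
    have hv := hnonneg v
    have heq' : 3 * (k * (u.val : ℤ) % n) / n = 3 * (k * (v.val : ℤ) % n) / n := by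
      omega
    rcases h with h | h | h | h
    · exact third_ne_of_inMiddleThird hn ha (hdvd _ _ _ h) heq'
    · exact third_ne_of_inMiddleThird hn ha (hdvd _ _ _ h) heq'.symm
    · exact third_ne_of_inMiddleThird hn hb (hdvd _ _ _ h) heq'
    · exact third_ne_of_inMiddleThird hn hb (hdvd _ _ _ h) heq'.symm

/-- Walking in steps of size at most `n / 3`, the middle third is reached after covering a
distance of at most `2 * n / 3`, up to one step. -/
theorem exists_mul_inMiddleThird {n c : ℤ} (hc : 0 < c) (hcn : 3 * c ≤ n) (i : ℤ) :
    ∃ j, i ≤ j ∧ 3 * (c * (j - i)) ≤ 2 * n + 3 * c ∧ InMiddleThird n (c * j) := by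
  have hn : 0 < n := by linarith
  have hx := Int.emod_add_mul_ediv (c * i) n
  have hx1 := Int.emod_nonneg (c * i) hn.ne'
  have hx2 := Int.emod_lt_of_pos (c * i) hn
  set s := c * i % n
  set q := c * i / n
  have key : ∀ t d : ℤ, 0 ≤ d → 3 * d ≤ 2 * n + 2 → n ≤ 3 * (d + c * i - t * n) →
      3 * (d + c * i - t * n) ≤ n + 2 →
      ∃ j, i ≤ j ∧ 3 * (c * (j - i)) ≤ 2 * n + 3 * c ∧ InMiddleThird n (c * j) := by
    intro t d hd0 hd h1 h2
    have e := Int.emod_add_mul_ediv (d + c - 1) c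
    have e1 := Int.emod_nonneg (d + c - 1) hc.ne'
    have e2 := Int.emod_lt_of_pos (d + c - 1) hc
    have e3 : 0 ≤ (d + c - 1) / c := Int.ediv_nonneg (by omega) hc.le
    set m := (d + c - 1) / c
    refine ⟨i + m, by omega, ?_, inMiddleThird_of_between t hn ?_ ?_⟩
    · rw [add_sub_cancel_left]
      linarith
    · rw [mul_add]; linarith
    · rw [mul_add]; linarith
  by_cases hs1 : 3 * s < n
  · exact key q ((n + 2) / 3 - s) (by omega) (by omega)
      (by rw [← hx, mul_comm q]; ring_nf; omega) (by rw [← hx, mul_comm q]; ring_nf; omega)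
  · by_cases hs2 : 3 * s ≤ 2 * n
    · exact ⟨i, le_rfl, by simp; linarith, by unfold InMiddleThird; omega⟩
    · exact key (q + 1) (n + (n + 2) / 3 - s) (by omega) (by omega)
        (by rw [← hx]; ring_nf; omega) (by rw [← hx]; ring_nf; omega)

theorem exists_dilation_of_large {n b : ℤ} (hn : 60 ≤ n) (hb : 3 ≤ b) (hbn : 2 * b + 2 ≤ n) :
    ∃ k, InMiddleThird n k ∧ InMiddleThird n (k * b) := by
  have hn0 : 0 < n := by linarith
  have hmid : ∀ k : ℤ, n ≤ 3 * k → 3 * k ≤ 2 * n → InMiddleThird n k := fun k h1 h2 =>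
    inMiddleThird_of_between 0 hn0 (by linarith) (by linarith)
  by_cases hb3 : 3 * b ≤ n
  · obtain ⟨k, hk1, hk2, hk3⟩ := exists_mul_inMiddleThird (by linarith) hb3 ((n + 2) / 3)
    refine ⟨k, hmid k (by omega) ?_, by rwa [mul_comm]⟩
    by_contra! hlt
    have h1 : 0 ≤ (b - 3) * (k - (n + 2) / 3 - 1) := mul_nonneg (by omega) (by omega)
    have h2 : 9 * (k - (n + 2) / 3 - 1) ≤ 2 * n := by linarith
    omega
  · obtain ⟨c, hc⟩ : ∃ c, c = n - 2 * b := ⟨_, rfl⟩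
    have heven : ∀ j, InMiddleThird n (c * j) → InMiddleThird n (2 * j * b) := by
      intro j hj
      rw [inMiddleThird_congr (y := -(c * j)) ⟨j, by rw [hc]; ring⟩]
      exact inMiddleThird_neg hn0 hj
    rcases (by omega : c = 2 ∨ c = 3 ∨ c = 4 ∨ 5 ≤ c) with rfl | rfl | rfl | hc5
    · exact ⟨2 * ((n + 5) / 6), hmid _ (by omega) (by omega),
        heven _ (hmid _ (by omega) (by omega))⟩
    · exact ⟨2 * ((n + 5) / 6), hmid _ (by omega) (by omega),
        heven _ (hmid _ (by omega) (by omega))⟩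
    · refine ⟨2 * (n / 4) + 1, hmid _ (by omega) (by omega), ?_⟩
      refine inMiddleThird_of_between (n / 4 - 1) hn0 ?_ ?_ <;>
      · obtain ⟨q, hq⟩ : ∃ q, q = n / 4 := ⟨_, rfl⟩
        have hb' : n = 2 * b + 4 := by linarith
        rw [← hq, show (2 * q + 1) * b - (q - 1) * n = 3 * b + 4 - 4 * q by rw [hb']; ring]
        omega
    · obtain ⟨j, hj1, hj2, hj3⟩ :=
        exists_mul_inMiddleThird (by linarith) (by omega : 3 * c ≤ n) ((n + 5) / 6)
      refine ⟨2 * j, hmid _ (by omega) ?_, heven j hj3⟩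
      by_contra! hlt
      have h1 : 0 ≤ (c - 5) * (j - (n + 5) / 6 - 1) := mul_nonneg (by omega) (by omega)
      have h2 : 15 * (j - (n + 5) / 6 - 1) ≤ 2 * n := by linarith
      omega

set_option synthInstance.maxSize 1000 in
set_option synthInstance.maxHeartbeats 200000 in
theorem exists_dilation_of_small : ∀ n < (60 : ℕ), ∀ b < n, 3 ≤ b → 2 * b + 2 ≤ n →
    ¬ (n = 13 ∧ b = 5) → ∃ k < n, InMiddleThird n k ∧ InMiddleThird n (k * b) := by
  decide +kernel

theorem exists_dilation_of_not_unit {d p a b : ℤ} (hd : 3 ≤ d) (hp : 2 ≤ p)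
    (ha : IsCoprime a p) (hb : IsCoprime b d) :
    ∃ k, InMiddleThird (d * p) (k * (d * a)) ∧ InMiddleThird (d * p) (k * b) := by
  obtain ⟨u, u', hu⟩ := ha
  obtain ⟨v, v', hv⟩ := hb
  have hn : 0 < d * p := by positivity
  have hdp : 3 * p ≤ d * p := by nlinarith
  obtain ⟨i, hi⟩ : ∃ i, i = u * (p / 2) := ⟨_, rfl⟩
  obtain ⟨m, hm⟩ : ∃ m, m = (d * p + 2) / 3 := ⟨_, rfl⟩
  have he := Int.emod_add_mul_ediv (b * i - m) p
  have he1 := Int.emod_nonneg (b * i - m) (by omega : p ≠ 0)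
  have he2 := Int.emod_lt_of_pos (b * i - m) (by omega : 0 < p)
  set w := (b * i - m) / p
  refine ⟨i - p * (v * w), ?_, ?_⟩
  · rw [inMiddleThird_congr (y := d * (p / 2))
      ⟨-(u' * (p / 2)) - v * w * a, by rw [hi]; linear_combination d * (p / 2) * hu⟩]
    have h1 : p ≤ 3 * (p / 2) := by omega
    have h2 : 3 * (p / 2) ≤ 2 * p := by omega
    refine inMiddleThird_of_between 0 hn ?_ ?_ <;> nlinarith
  · rw [inMiddleThird_congr (y := b * i - p * w) ⟨v' * w, by linear_combination - p * w * hv⟩]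
    refine inMiddleThird_of_between 0 hn ?_ ?_ <;> omega

theorem ZMod.val_add_natCast_cases {n : ℕ} [NeZero n] {u v : ZMod n} {a : ℕ} (ha : a < n)
    (h : v - u = (a : ZMod n)) : u.val + a = v.val ∨ u.val + a = v.val + n := by
  have h1 : v = u + (a : ZMod n) := by rw [← h]; ring
  have h2 := ZMod.val_add u (a : ZMod n)
  rw [← h1, ZMod.val_natCast_of_lt ha] at h2
  have hu := u.val_lt
  rcases lt_or_ge (u.val + a) n with hlt | hge
  · rw [Nat.mod_eq_of_lt hlt] at h2
    exact Or.inl h2.symm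
  · rw [Nat.mod_eq_sub_mod hge, Nat.mod_eq_of_lt (by omega)] at h2
    omega

theorem circulantPair_adj_val {n : ℕ} [NeZero n] {a b : ℕ} (ha : a < n) (hb : b < n)
    {u v : ZMod n} (h : (circulantPair n (a : ZMod n) (b : ZMod n)).Adj u v) :
    u.val + a = v.val ∨ u.val + a = v.val + n ∨ v.val + a = u.val ∨ v.val + a = u.val + n ∨
    u.val + b = v.val ∨ u.val + b = v.val + n ∨ v.val + b = u.val ∨ v.val + b = u.val + n := by
  rcases h.2 with h | h | h | h
  · have := ZMod.val_add_natCast_cases ha h; tauto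
  · have := ZMod.val_add_natCast_cases ha h; tauto
  · have := ZMod.val_add_natCast_cases hb h; tauto
  · have := ZMod.val_add_natCast_cases hb h; tauto

/-- The squared cycle of length `n ≡ 1 (mod 3)`, coloured `012 ⋯ 012 3`. -/
theorem semitransitive_one_two_of_mod_three_eq_one {n : ℕ} (hn : 7 ≤ n) (h3 : n % 3 = 1) :
    (circulantPair n ((1 : ℕ) : ZMod n) ((2 : ℕ) : ZMod n)).Semitransitive := by
  have : NeZero n := ⟨by omega⟩
  have hadj := fun (u v : ZMod n) => circulantPair_adj_val (n := n) (u := u) (v := v)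
    (by omega : 1 < n) (by omega : 2 < n)
  obtain ⟨f, hf⟩ : ∃ f : ℕ → ℕ, ∀ x, f x = if x + 1 = n then 3 else x % 3 := ⟨_, fun _ => rfl⟩
  refine SimpleGraph.semitransitive_of_fourColoring _ (fun v => f v.val) ?_ ?_ ?_
  · intro v
    have := v.val_lt
    simp only [hf]
    split_ifs <;> omega
  · intro u v huv
    have hu := u.val_lt
    have hv := v.val_lt
    have := hadj u v huv
    simp only [hf]
    split_ifs <;> omega
  · intro x y z w hx hy hz hw hxy hyz hzw hxw
    have bx := x.val_lt
    have bY := y.val_lt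
    have bz := z.val_lt
    have bw := w.val_lt
    have axy := hadj x y hxy
    have ayz := hadj y z hyz
    have azw := hadj z w hzw
    have axw := hadj x w hxw
    simp only [hf] at hx hy hz hw
    generalize x.val = x at *
    generalize y.val = y at *
    generalize z.val = z at *
    generalize w.val = w at *
    clear hxy hyz hzw hxw hadj hf
    have ew : w + 1 = n := by
      clear hx hy hz axy ayz azw axw
      split_ifs at hw
      all_goals omega
    clear hw
    have ex : x = 0 ∧ w + 1 = n := by
      clear hy hz axy ayz azw
      split_ifs at hx
      all_goals omega
    have ez : z + 1 = w := by
      clear hx hy axy ayz axw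
      split_ifs at hz <;> omega
    clear hx hz azw axw ew
    split_ifs at hy <;> omega

/-- The squared cycle of length `n ≡ 2 (mod 3)`, coloured `012 ⋯ 012 3 012 3`. -/
theorem semitransitive_one_two_of_mod_three_eq_two {n : ℕ} (hn : 7 ≤ n) (h3 : n % 3 = 2) :
    (circulantPair n ((1 : ℕ) : ZMod n) ((2 : ℕ) : ZMod n)).Semitransitive := by
  have : NeZero n := ⟨by omega⟩
  have hadj := fun (u v : ZMod n) => circulantPair_adj_val (n := n) (u := u) (v := v)
    (by omega : 1 < n) (by omega : 2 < n)
  obtain ⟨f, hf⟩ : ∃ f : ℕ → ℕ, ∀ x, f x = 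
      if x + 1 = n ∨ x + 5 = n then 3 else if n < x + 5 then x + 4 - n else x % 3 := ⟨_, fun _ => rfl⟩
  refine SimpleGraph.semitransitive_of_fourColoring _ (fun v => f v.val) ?_ ?_ ?_
  · intro v
    have := v.val_lt
    simp only [hf]
    split_ifs <;> omega
  · intro u v huv
    have hu := u.val_lt
    have hv := v.val_lt
    have := hadj u v huv
    simp only [hf]
    split_ifs <;> omega
  · intro x y z w hx hy hz hw hxy hyz hzw hxw
    have bx := x.val_lt
    have bY := y.val_lt
    have bz := z.val_lt
    have bw := w.val_lt
    have axy := hadj x y hxy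
    have ayz := hadj y z hyz
    have azw := hadj z w hzw
    have axw := hadj x w hxw
    simp only [hf] at hx hy hz hw
    generalize x.val = x at *
    generalize y.val = y at *
    generalize z.val = z at *
    generalize w.val = w at *
    clear hxy hyz hzw hxw hadj hf
    have ew : w + 1 = n ∨ w + 5 = n := by
      clear hx hy hz axy ayz azw axw
      split_ifs at hw <;> omega
    clear hw
    have ex : x = 0 ∧ w + 1 = n ∨ x + 4 = n ∧ w + 5 = n := by
      clear hy hz axy ayz azw
      split_ifs at hx <;> omega
    have ez : z + 1 = w := by
      clear hx hy axy ayz axw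
      split_ifs at hz <;> omega
    clear hx hz azw axw ew
    split_ifs at hy <;> omega

/-- The squared cycle is semi-transitive. -/
theorem semitransitive_one_two {n : ℕ} (hn : 5 ≤ n) :
    (circulantPair n ((1 : ℕ) : ZMod n) ((2 : ℕ) : ZMod n)).Semitransitive := by
  have : NeZero n := ⟨by omega⟩
  rcases (by omega : n % 3 = 0 ∨ n % 3 = 1 ∨ n % 3 = 2) with h3 | h3 | h3
  · have h := semitransitive_of_inMiddleThird (n := n) (a := 1) (b := 2) (n / 3 : ℤ)
      (inMiddleThird_of_between 0 (by omega) (by omega) (by omega))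
      (inMiddleThird_of_between 0 (by omega) (by omega) (by omega))
    simpa using h
  · exact semitransitive_one_two_of_mod_three_eq_one (by omega) h3
  by_cases h5 : n = 5
  · subst h5
    have hcomplete : ∀ u v : ZMod 5, u ≠ v →
        (circulantPair 5 ((1 : ℕ) : ZMod 5) ((2 : ℕ) : ZMod 5)).Adj u v := by
      simp only [circulantPair_adj]
      decide
    refine SimpleGraph.semitransitive_of_rank _ ZMod.val
      (fun u v huv heq => huv.1 (ZMod.val_injective _ heq)) ?_
    intro k p _ hmono _ i j hij
    exact hcomplete _ _ fun heq => (hmono hij).ne (congrArg ZMod.val heq)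
  · exact semitransitive_one_two_of_mod_three_eq_two (by omega) h3

theorem semitransitive_thirteen :
    (circulantPair 13 ((1 : ℕ) : ZMod 13) ((5 : ℕ) : ZMod 13)).Semitransitive := by
  refine SimpleGraph.semitransitive_of_fourColoring _
    (fun v : ZMod 13 => ([0, 1, 0, 1, 2, 3, 0, 1, 2, 0, 1, 2, 3] : List ℕ).getD v.val 0) ?_ ?_ ?_
  · decide
  · simp only [circulantPair_adj]
    decide +kernel
  · simp only [circulantPair_adj]
    decide +kernel

theorem semitransitive_one_natCast {n b : ℕ} (hb : 2 ≤ b) (hbn : 2 * b < n) :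
    (circulantPair n ((1 : ℕ) : ZMod n) (b : ZMod n)).Semitransitive := by
  have : NeZero n := ⟨by omega⟩
  rcases eq_or_lt_of_le hb with rfl | hb3
  · exact semitransitive_one_two (by omega)
  rcases eq_or_lt_of_le (Nat.succ_le_of_lt hbn) with hbn' | hbn'
  · have h2b : (2 : ZMod n) * b = -1 := by
      have h : ((2 * b + 1 : ℕ) : ZMod n) = 0 := by rw [← hbn']; simp
      push_cast at h
      linear_combination h
    refine semitransitive_of_unit_mul 2 (IsUnit.of_mul_eq_one (-(b : ZMod n)) ?_) ?_
    · linear_combination -h2b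
    · rw [h2b, circulantPair_neg_right, circulantPair_comm]
      simpa using semitransitive_one_two (n := n) (by omega)
  by_cases h13 : n = 13 ∧ b = 5
  · obtain ⟨rfl, rfl⟩ := h13
    exact semitransitive_thirteen
  obtain ⟨k, hk1, hk2⟩ : ∃ k : ℤ, InMiddleThird n k ∧ InMiddleThird n (k * b) := by
    by_cases hn : n < 60
    · obtain ⟨k, -, hk⟩ := exists_dilation_of_small n hn b (by omega) hb3 (by omega) h13
      exact ⟨k, hk⟩
    · exact exists_dilation_of_large (by omega) (by omega) (by omega)
  have := semitransitive_of_inMiddleThird (a := 1) (b := b) k (by rwa [mul_one]) hk2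
  simpa using this

theorem semitransitive_one {n : ℕ} [NeZero n] {c : ZMod n} (h0 : 2 * c ≠ 0) (h1 : c ≠ 1)
    (h2 : c ≠ -1) : (circulantPair n 1 c).Semitransitive := by
  have key : ∀ c : ZMod n, 2 * c ≠ 0 → c ≠ 1 → 2 * c.val < n →
      (circulantPair n 1 c).Semitransitive := by
    intro c h0 h1 hlt
    have hv : ((c.val : ℕ) : ZMod n) = c := ZMod.natCast_zmod_val c
    have := semitransitive_one_natCast (n := n) (b := c.val) (by
      by_contra! hlt2
      interval_cases h : c.val
      · exact h0 (by rw [← hv]; simp)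
      · exact h1 (by rw [← hv]; simp)) hlt
    simpa [hv] using this
  by_cases hlt : 2 * c.val < n
  · exact key c h0 h1 hlt
  · rw [← circulantPair_neg_right]
    refine key (-c) (fun h => h0 (by linear_combination -h))
      (fun h => h2 (by rw [← h, neg_neg])) ?_
    have hc : c ≠ 0 := fun h => h0 (by rw [h, mul_zero])
    have : NeZero c := ⟨hc⟩
    rw [ZMod.val_neg_of_ne_zero]
    have hne : 2 * c.val ≠ n := by
      intro h
      apply h0
      have : ((2 * c.val : ℕ) : ZMod n) = 0 := by rw [h]; simp
      simpa using this
    have := c.val_lt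
    omega

theorem semitransitive_of_isUnit {n : ℕ} [NeZero n] {a b : ZMod n} (ha : IsUnit a)
    (hb : 2 * b ≠ 0) (h1 : b ≠ a) (h2 : b ≠ -a) : (circulantPair n a b).Semitransitive := by
  obtain ⟨u, rfl⟩ := ha
  refine semitransitive_of_unit_mul (↑u⁻¹ : ZMod n) u⁻¹.isUnit ?_
  have hub : b = u * (↑u⁻¹ * b) := by rw [Units.mul_inv_cancel_left]
  rw [Units.inv_mul]
  refine semitransitive_one (fun h => hb ?_) (fun h => h1 ?_) fun h => h2 ?_
  · rw [hub]; linear_combination (u : ZMod n) * h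
  · rw [hub, h, mul_one]
  · rw [hub, h, mul_neg, mul_one]

theorem semitransitive_of_three_le_gcd {n : ℕ} [NeZero n] {a b : ℤ} (ha : ¬ (n : ℤ) ∣ a)
    (hd : 3 ≤ Int.gcd a n) (hb : IsCoprime b (Int.gcd a n : ℤ)) :
    (circulantPair n (a : ZMod n) (b : ZMod n)).Semitransitive := by
  have hn : (0 : ℤ) < n := by exact_mod_cast Nat.pos_of_ne_zero (NeZero.ne n)
  obtain ⟨a', p, hcop, ha', hp⟩ := Int.exists_gcd_one (by omega : 0 < Int.gcd a n)
  set d : ℤ := (Int.gcd a n : ℤ) with hdd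
  have hp2 : 2 ≤ p := by
    by_contra! hlt
    have hp0 : 0 < p := by
      rw [hp] at hn
      exact pos_of_mul_pos_left hn (by omega)
    have hp1 : p = 1 := by omega
    apply ha
    rw [ha', hp, hp1, one_mul]
    exact Dvd.intro_left _ rfl
  obtain ⟨k, hk1, hk2⟩ := exists_dilation_of_not_unit (d := d) (p := p) (a := a') (b := b)
    (by omega) hp2 (Int.isCoprime_iff_gcd_eq_one.2 hcop) hb
  refine semitransitive_of_inMiddleThird k ?_ ?_
  · rwa [hp, ha', mul_comm p, mul_comm a']
  · rwa [hp, mul_comm p]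

theorem semitransitive_of_isCoprime {n : ℕ} [NeZero n] {a b : ℤ}
    (hcop : Int.gcd (Int.gcd a n) (Int.gcd b n) = 1)
    (ha : 2 * (a : ZMod n) ≠ 0) (hb : 2 * (b : ZMod n) ≠ 0) (h1 : (b : ZMod n) ≠ a)
    (h2 : (b : ZMod n) ≠ -a) :
    (circulantPair n (a : ZMod n) (b : ZMod n)).Semitransitive := by
  have hunit : ∀ c : ℤ, Int.gcd c n = 1 → IsUnit (c : ZMod n) := by
    intro c hc
    obtain ⟨u, v, huv⟩ := Int.isCoprime_iff_gcd_eq_one.2 hc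
    refine IsUnit.of_mul_eq_one (u : ZMod n) ?_
    have := congrArg (Int.cast : ℤ → ZMod n) huv
    push_cast at this
    rw [ZMod.natCast_self, mul_zero, add_zero] at this
    rw [mul_comm, this]
  have hndvd : ∀ c : ℤ, 2 * (c : ZMod n) ≠ 0 → ¬ (n : ℤ) ∣ c := by
    intro c hc hdvd
    rw [(ZMod.intCast_zmod_eq_zero_iff_dvd c n).2 hdvd, mul_zero] at hc
    exact hc rfl
  have hpos : ∀ c : ℤ, 0 < Int.gcd c n := fun c =>
    Int.gcd_pos_of_ne_zero_right _ (by exact_mod_cast NeZero.ne n)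
  by_cases hua : Int.gcd a n = 1
  · exact semitransitive_of_isUnit (hunit a hua) hb h1 h2
  by_cases hub : Int.gcd b n = 1
  · rw [circulantPair_comm]
    exact semitransitive_of_isUnit (hunit b hub) ha h1.symm fun h => h2 (by rw [h, neg_neg])
  have hab : IsCoprime (Int.gcd a n : ℤ) (Int.gcd b n : ℤ) := Int.isCoprime_iff_gcd_eq_one.2 hcop
  have hcoprime : ∀ a b : ℤ, IsCoprime (Int.gcd a n : ℤ) (Int.gcd b n : ℤ) →
      IsCoprime b (Int.gcd a n : ℤ) := by
    intro a b h
    rw [Int.isCoprime_iff_gcd_eq_one] at h ⊢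
    apply Nat.eq_one_of_dvd_one
    rw [← h]
    apply Int.dvd_gcd
    · exact Int.gcd_dvd_right ..
    · exact Int.dvd_coe_gcd (Int.gcd_dvd_left ..)
        ((Int.gcd_dvd_right ..).trans (Int.gcd_dvd_right ..))
  have hposa := hpos a
  have hposb := hpos b
  rcases (by omega : 3 ≤ Int.gcd a n ∨ 3 ≤ Int.gcd b n ∨ Int.gcd a n = 2 ∧ Int.gcd b n = 2)
    with h | h | h
  · exact semitransitive_of_three_le_gcd (hndvd a ha) h (hcoprime a b hab)
  · rw [circulantPair_comm]
    exact semitransitive_of_three_le_gcd (hndvd b hb) h (hcoprime b a hab.symm)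
  · rw [h.1, h.2] at hcop
    exact absurd hcop (by decide)

theorem semitransitive_circulantPair {n : ℕ} [NeZero n] {a b : ℤ}
    (ha : 2 * (a : ZMod n) ≠ 0) (hb : 2 * (b : ZMod n) ≠ 0) (h1 : (b : ZMod n) ≠ a)
    (h2 : (b : ZMod n) ≠ -a) :
    (circulantPair n (a : ZMod n) (b : ZMod n)).Semitransitive := by
  obtain ⟨g, hg⟩ : ∃ g : ℕ, g = Int.gcd (Int.gcd a n) (Int.gcd b n) := ⟨_, rfl⟩
  have hg0 : 0 < g := by
    rw [hg]
    exact Int.gcd_pos_of_ne_zero_left _ (by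
      exact_mod_cast (Int.gcd_pos_of_ne_zero_right _ (by exact_mod_cast NeZero.ne n)).ne')
  have hga' : (g : ℤ) ∣ Int.gcd a n := by rw [hg]; exact Int.gcd_dvd_left ..
  have hgb' : (g : ℤ) ∣ Int.gcd b n := by rw [hg]; exact Int.gcd_dvd_right ..
  obtain ⟨a, rfl⟩ : (g : ℤ) ∣ a := hga'.trans (Int.gcd_dvd_left ..)
  obtain ⟨b, rfl⟩ : (g : ℤ) ∣ b := hgb'.trans (Int.gcd_dvd_left ..)
  obtain ⟨m, rfl⟩ : g ∣ n := Int.natCast_dvd_natCast.1 (hga'.trans (Int.gcd_dvd_right ..))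
  have : NeZero g := ⟨hg0.ne'⟩
  have : NeZero m := ⟨fun h => NeZero.ne (g * m) (by rw [h, mul_zero])⟩
  have hlift : ∀ c : ℤ, (c : ZMod m) = 0 → ((g * c : ℤ) : ZMod (g * m)) = 0 := by
    intro c hc
    rw [ZMod.intCast_zmod_eq_zero_iff_dvd] at hc ⊢
    push_cast
    exact mul_dvd_mul_left _ hc
  refine semitransitive_of_mul_left a b (semitransitive_of_isCoprime ?_ ?_ ?_ ?_ ?_)
  · have hmul : ∀ c : ℤ, (Int.gcd (g * c) ((g * m : ℕ) : ℤ) : ℤ) = g * (Int.gcd c m : ℤ) := by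
      intro c
      push_cast
      rw [Int.gcd_mul_left]
      simp
    rw [hmul, hmul, Int.gcd_mul_left, Int.natAbs_natCast] at hg
    exact (Nat.eq_of_mul_eq_mul_left hg0 (by rw [mul_one]; exact hg)).symm
  · intro h
    have := hlift (2 * a) (by push_cast; exact h)
    push_cast at this ha
    exact ha (by linear_combination this)
  · intro h
    have := hlift (2 * b) (by push_cast; exact h)
    push_cast at this hb
    exact hb (by linear_combination this)
  · intro h
    have := hlift (b - a) (by push_cast; exact sub_eq_zero.2 h)
    push_cast at this h1
    exact h1 (by linear_combination this)
  · intro h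
    have := hlift (b + a) (by push_cast; rw [h]; ring)
    push_cast at this h2
    exact h2 (by linear_combination this)

/-- `ZMod n` has at most one nonzero element of order two. -/
theorem ZMod.eq_of_neg_eq_self {n : ℕ} [NeZero n] {x y : ZMod n} (hx0 : x ≠ 0) (hy0 : y ≠ 0)
    (hx : -x = x) (hy : -y = y) : x = y := by
  rcases (ZMod.neg_eq_self_iff x).1 hx with h | h
  · exact absurd h hx0
  rcases (ZMod.neg_eq_self_iff y).1 hy with h' | h'
  · exact absurd h' hy0
  exact ZMod.val_injective n (by omega)

theorem ZMod.exists_eq_pair_of_ncard_eq_four {n : ℕ} [NeZero n] {T : Set (ZMod n)}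
    (h0 : (0 : ZMod n) ∉ T) (hneg : ∀ x ∈ T, -x ∈ T) (hT : T.ncard = 4) :
    ∃ a b : ZMod n, -a ≠ a ∧ -b ≠ b ∧ b ≠ a ∧ b ≠ -a ∧ T = {a, -a, b, -b} := by
  have hne0 : ∀ x ∈ T, x ≠ 0 := fun x hx h => h0 (h ▸ hx)
  obtain ⟨a, haT, ha⟩ : ∃ a ∈ T, -a ≠ a := by
    obtain ⟨x, hx, y, hy, hxy⟩ := (Set.one_lt_ncard_iff_nontrivial).1 (by omega : 1 < T.ncard)
    by_contra! hall
    exact hxy (ZMod.eq_of_neg_eq_self (hne0 x hx) (hne0 y hy) (hall x hx) (hall y hy))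
  have hsub : ({a, -a} : Set (ZMod n)) ⊆ T := by
    rintro x (rfl | rfl)
    · exact haT
    · exact hneg _ haT
  have hcard : (T \ {a, -a}).ncard = 2 := by
    rw [Set.ncard_sdiff hsub, hT, Set.ncard_pair ha.symm]
  have hmem : ∀ x, x ∈ T \ {a, -a} → -x ∈ T \ {a, -a} := by
    rintro x ⟨hx, hxa⟩
    refine ⟨hneg x hx, fun h => hxa ?_⟩
    rcases h with h | h
    · exact Or.inr (by rw [Set.mem_singleton_iff, ← h, neg_neg])
    · exact Or.inl (neg_inj.1 h)
  obtain ⟨x, y, hxy, hU⟩ := Set.ncard_eq_two.1 hcard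
  have hxU : x ∈ T \ {a, -a} := by rw [hU]; exact Or.inl rfl
  have hyU : y ∈ T \ {a, -a} := by rw [hU]; exact Or.inr rfl
  have hnx := hmem x hxU
  have hny := hmem y hyU
  rw [hU] at hnx hny
  have hyx : y = -x := by
    rcases hnx with hnx | hnx
    · rcases hny with hny | hny
      · rw [← hny, neg_neg]
      · exact absurd (ZMod.eq_of_neg_eq_self (hne0 x hxU.1) (hne0 y hyU.1) hnx hny) hxy
    · exact hnx.symm
  refine ⟨a, x, ha, fun h => hxy (by rw [hyx, h]), fun h => hxU.2 (Or.inl h),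
    fun h => hxU.2 (Or.inr h), ?_⟩
  rw [← Set.union_sdiff_cancel hsub, hU, hyx]
  ext z
  simp only [Set.mem_union, Set.mem_insert_iff, Set.mem_singleton_iff]
  tauto

theorem circulant_adj_iff_sub_mem (n : ℕ) (S : Set ℤ) (u v : ZMod n) :
    (circulant n S).Adj u v ↔ v - u ∈ (circulant n S).neighborSet 0 := by
  simp only [circulant, SimpleGraph.mem_neighborSet, SimpleGraph.fromRel_adj, zero_sub, sub_zero,
    neg_sub, ne_eq]
  rw [eq_comm (a := (0 : ZMod n)), sub_eq_zero, eq_comm (a := v)]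

/-- Every 4-regular circulant graph is semi-transitive: for every `n ≥ 1` and every set `S` of
integers such that every vertex of `C(n; S)` has exactly 4 neighbours, `C(n; S)` is
semi-transitive. -/
theorem circulant_four_regular_semitransitive (n : ℕ) (hn : 1 ≤ n) (S : Set ℤ)
    (hreg : ∀ v : ZMod n, ((circulant n S).neighborSet v).ncard = 4) :
    (circulant n S).Semitransitive := by
  have : NeZero n := ⟨by omega⟩
  obtain ⟨a, b, ha, hb, h1, h2, hT⟩ := ZMod.exists_eq_pair_of_ncard_eq_four
    (T := (circulant n S).neighborSet 0) (fun h => (circulant n S).loopless.irrefl 0 h)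
    (fun x hx => by
      have h := (circulant_adj_iff_sub_mem n S x 0).1 (SimpleGraph.Adj.symm hx)
      rwa [zero_sub] at h)
    (hreg 0)
  have hG : circulant n S = circulantPair n ((a.val : ℤ) : ZMod n) ((b.val : ℤ) : ZMod n) := by
    ext u v
    have hne : (circulant n S).Adj u v → u ≠ v := fun h => h.ne
    have hneg : ∀ c : ZMod n, v - u = -c ↔ u - v = c := fun c => by
      rw [← neg_sub u v, neg_inj]
    rw [circulant_adj_iff_sub_mem, hT] at *
    simp only [Set.mem_insert_iff, Set.mem_singleton_iff, hneg] at hne ⊢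
    simp only [circulantPair_adj, Int.cast_natCast, ZMod.natCast_zmod_val]
    tauto
  have h2ne : ∀ c : ZMod n, -c ≠ c → 2 * c ≠ 0 := fun c hc h =>
    hc (by linear_combination -h)
  rw [hG]
  apply semitransitive_circulantPair <;> rw [Int.cast_natCast, ZMod.natCast_zmod_val]
  · exact h2ne a ha
  · exact h2ne b hb
  · rwa [Int.cast_natCast, ZMod.natCast_zmod_val]
  · rwa [Int.cast_natCast, ZMod.natCast_zmod_val]
end
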